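/- arXiv:2204.06590 — 2 statements merged into one kernel-verified Lean document; each statement's English description precedes it below -/
import Mathlib

section
/- Localized interpolation estimate: Let n ≥ 1 be an integer, s ∈ (0,1), and 1 < p < γ ≤ p/s. Let B_ρ ⊂ ℝⁿ be an open ball of radius ρ > 0. There is a constant c = c(n, p, s, γ) > 0 such that for every continuously differentiable function w : ℝⁿ → ℝ whose support is a compact subset of B_ρ, one has ( |B_ρ|⁻¹ ∬_{B_ρ×B_ρ} |w(x) − w(y)|^γ / |x−y|^{n+sγ} dx dy )^{1/γ} ≤ c (sup_{B_ρ} |w|)^{1−s} ( |B_ρ|⁻¹ ∫_{B_ρ} |Dw|^p dx )^{s/p}. -/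
open MeasureTheory Metric Set

section

/-- The function `u ↦ u ^ γ` continued linearly beyond the threshold `M`. -/
noncomputable def truncatedPower (M γ u : ℝ) : ℝ :=
  if u ≤ M then u ^ γ else M ^ (γ - 1) * u

theorem measurable_truncatedPower (M γ : ℝ) : Measurable (truncatedPower M γ) :=
  Measurable.ite measurableSet_Iic (by fun_prop) (by fun_prop)

theorem truncatedPower_nonneg {M γ u : ℝ} (hM : 0 ≤ M) (hu : 0 ≤ u) :
    0 ≤ truncatedPower M γ u := by
  unfold truncatedPower
  split_ifs <;> positivity

theorem rpow_sub_one_mul_le_truncatedPower {M γ D u : ℝ} (hγ : 1 < γ) (hD : 0 ≤ D)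
    (hDM : D ≤ 2 * M) (hu : 0 ≤ u) :
    D ^ (γ - 1) * u ≤ D ^ γ / 2 + 2 ^ (γ - 1) * truncatedPower M γ u := by
  have hM : 0 ≤ M := by linarith
  have key {x : ℝ} (hx : 0 ≤ x) : x ^ (γ - 1) * x = x ^ γ := by
    rcases hx.eq_or_lt with rfl | h
    · rw [Real.zero_rpow (by linarith), Real.zero_rpow (by linarith), zero_mul]
    · rw [Real.rpow_sub_one h.ne', div_mul_cancel₀ _ h.ne']
  have hΦ := truncatedPower_nonneg (γ := γ) hM hu
  by_cases h : u ≤ D / 2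
  · calc D ^ (γ - 1) * u ≤ D ^ (γ - 1) * (D / 2) := by gcongr
      _ = D ^ γ / 2 := by rw [← key hD]; ring
      _ ≤ _ := le_add_of_nonneg_right (by positivity)
  · have hDu : D ≤ 2 * u := by linarith
    refine le_trans ?_ (le_add_of_nonneg_left (by positivity))
    unfold truncatedPower
    split_ifs with huM
    · calc D ^ (γ - 1) * u ≤ (2 * u) ^ (γ - 1) * u := by
            gcongr
        _ = _ := by rw [Real.mul_rpow two_pos.le hu, mul_assoc, key hu]
    · calc D ^ (γ - 1) * u ≤ (2 * M) ^ (γ - 1) * u := by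
            gcongr
        _ = _ := by rw [Real.mul_rpow two_pos.le hM, mul_assoc]

variable {E : Type*} [NormedAddCommGroup E] [NormedSpace ℝ E]

theorem ofReal_abs_sub_rpow_le_lintegral_truncatedPower {w : E → ℝ} (hw : ContDiff ℝ 1 w)
    {M γ : ℝ} (hM : ∀ x, |w x| ≤ M) (hγ : 1 < γ) (x h : E) :
    ENNReal.ofReal (|w (x + h) - w x| ^ γ) ≤ ENNReal.ofReal (2 ^ γ) *
      ∫⁻ t in Ioc (0 : ℝ) 1,
        ENNReal.ofReal (truncatedPower M γ (‖h‖ * ‖fderiv ℝ w (x + t • h)‖)) := by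
  have hcont : Continuous (fderiv ℝ w) := hw.continuous_fderiv one_ne_zero
  set D := |w (x + h) - w x| with hD
  set u : ℝ → ℝ := fun t ↦ ‖h‖ * ‖fderiv ℝ w (x + t • h)‖ with hu
  have hu0 : ∀ t, 0 ≤ u t := fun t ↦ by positivity
  have hucont : Continuous u := by fun_prop
  have hD0 : 0 ≤ D := abs_nonneg _
  have hDM : D ≤ 2 * M := (abs_sub _ _).trans (by linarith [hM (x + h), hM x])
  have hDu : ENNReal.ofReal D ≤ ∫⁻ t in Ioc (0 : ℝ) 1, ENNReal.ofReal (u t) := by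
    have hderiv : ∀ t ∈ uIcc (0 : ℝ) 1,
        HasDerivAt (fun t : ℝ ↦ w (x + t • h)) (fderiv ℝ w (x + t • h) h) t := fun t _ ↦ by
      have h1 : HasDerivAt (fun t : ℝ ↦ x + t • h) h t := by
        simpa using ((hasDerivAt_id t).smul_const h).const_add x
      exact ((hw.differentiable one_ne_zero) (x + t • h)).hasFDerivAt.comp_hasDerivAt t h1
    have hftc := intervalIntegral.integral_eq_sub_of_hasDerivAt hderiv
      (Continuous.intervalIntegrable (by fun_prop) _ _)
    rw [one_smul, zero_smul, add_zero, intervalIntegral.integral_of_le zero_le_one] at hftc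
    rw [hD, ← hftc, ← Real.enorm_eq_ofReal_abs]
    refine (enorm_integral_le_lintegral_enorm _).trans (lintegral_mono fun t ↦ ?_)
    rw [← ofReal_norm]
    refine ENNReal.ofReal_le_ofReal ?_
    exact (ContinuousLinearMap.le_opNorm _ _).trans_eq (mul_comm _ _)
  have hpow : D ^ γ = D ^ (γ - 1) * D := by
    rcases hD0.eq_or_lt with h0 | h0
    · rw [← h0, mul_zero, Real.zero_rpow (by linarith)]
    · rw [Real.rpow_sub_one h0.ne', div_mul_cancel₀ _ h0.ne']
  set J := ∫⁻ t in Ioc (0 : ℝ) 1, ENNReal.ofReal (truncatedPower M γ (u t)) with hJ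
  have hM0 : 0 ≤ M := (abs_nonneg _).trans (hM x)
  have hmain : ENNReal.ofReal (D ^ γ / 2) + ENNReal.ofReal (D ^ γ / 2) ≤
      ENNReal.ofReal (D ^ γ / 2) + ENNReal.ofReal (2 ^ (γ - 1)) * J := by
    calc ENNReal.ofReal (D ^ γ / 2) + ENNReal.ofReal (D ^ γ / 2)
        = ENNReal.ofReal (D ^ (γ - 1)) * ENNReal.ofReal D := by
          rw [← ENNReal.ofReal_add (by positivity) (by positivity), add_halves, hpow,
            ENNReal.ofReal_mul (by positivity)]
      _ ≤ ENNReal.ofReal (D ^ (γ - 1)) * ∫⁻ t in Ioc (0 : ℝ) 1, ENNReal.ofReal (u t) := by gcongr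
      _ = ∫⁻ t in Ioc (0 : ℝ) 1, ENNReal.ofReal (D ^ (γ - 1) * u t) := by
          rw [← lintegral_const_mul _ (by fun_prop)]
          simp_rw [ENNReal.ofReal_mul (show 0 ≤ D ^ (γ - 1) by positivity)]
      _ ≤ ∫⁻ t in Ioc (0 : ℝ) 1, (ENNReal.ofReal (D ^ γ / 2) +
            ENNReal.ofReal (2 ^ (γ - 1)) * ENNReal.ofReal (truncatedPower M γ (u t))) := by
          refine lintegral_mono fun t ↦ ?_
          rw [← ENNReal.ofReal_mul (by positivity), ← ENNReal.ofReal_add (by positivity)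
            (mul_nonneg (by positivity) (truncatedPower_nonneg hM0 (hu0 t)))]
          exact ENNReal.ofReal_le_ofReal (rpow_sub_one_mul_le_truncatedPower hγ hD0 hDM (hu0 t))
      _ = _ := by
          rw [lintegral_add_left measurable_const, lintegral_const_mul' _ _ ENNReal.ofReal_ne_top]
          simp [hJ]
  have hhalf := (ENNReal.add_le_add_iff_left ENNReal.ofReal_ne_top).1 hmain
  calc ENNReal.ofReal (D ^ γ) = ENNReal.ofReal 2 * ENNReal.ofReal (D ^ γ / 2) := by
        rw [← ENNReal.ofReal_mul two_pos.le]
        congr 1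
        ring
    _ ≤ ENNReal.ofReal 2 * (ENNReal.ofReal (2 ^ (γ - 1)) * J) := by gcongr
    _ = _ := by
        rw [← mul_assoc, ← ENNReal.ofReal_mul two_pos.le, Real.rpow_sub_one two_ne_zero]
        congr 2
        ring

variable [FiniteDimensional ℝ E]

theorem pow_finrank_sub_one_mul_rpow [Nontrivial E] {y : ℝ} (hy : 0 < y) (α : ℝ) :
    y ^ (Module.finrank ℝ E - 1) * y ^ (-(Module.finrank ℝ E : ℝ) + α) = y ^ (α - 1) := by
  rw [← Real.rpow_natCast, ← Real.rpow_add hy, Nat.cast_sub Module.finrank_pos]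
  congr 1
  push_cast
  ring

variable [MeasurableSpace E] [BorelSpace E]

theorem lintegral_ofReal_fun_norm_addHaar [Nontrivial E] (μ : Measure E) [μ.IsAddHaarMeasure]
    {f : ℝ → ℝ} (hf : ∀ r, 0 ≤ f r)
    (hint : IntegrableOn (fun y : ℝ ↦ y ^ (Module.finrank ℝ E - 1) • f y) (Ioi 0)) :
    ∫⁻ x, ENNReal.ofReal (f ‖x‖) ∂μ = ENNReal.ofReal (Module.finrank ℝ E * μ.real (ball 0 1) *
      ∫ y in Ioi (0 : ℝ), y ^ (Module.finrank ℝ E - 1) • f y) := by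
  rw [← ofReal_integral_eq_lintegral_ofReal ((integrable_fun_norm_addHaar μ).2 hint)
    (.of_forall fun x ↦ hf _), integral_fun_norm_addHaar]
  simp [mul_assoc]

theorem setLIntegral_norm_rpow_compl_closedBall [Nontrivial E] (μ : Measure E)
    [μ.IsAddHaarMeasure] {α a : ℝ} (hα : 0 < α) (ha : 0 < a) :
    ∫⁻ h in {h : E | a < ‖h‖}, ENNReal.ofReal (‖h‖ ^ (-(Module.finrank ℝ E : ℝ) + -α)) ∂μ =
      ENNReal.ofReal (Module.finrank ℝ E * μ.real (ball 0 1) * (a ^ (-α) / α)) := by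
  have hms : MeasurableSet {h : E | a < ‖h‖} := measurableSet_lt measurable_const measurable_norm
  set f : ℝ → ℝ := (Ioi a).indicator fun r ↦ r ^ (-(Module.finrank ℝ E : ℝ) + -α) with hf
  have hcongr : EqOn (fun y ↦ y ^ (Module.finrank ℝ E - 1) • f y)
      ((Ioi a).indicator fun y ↦ y ^ (-α - 1)) (Ioi 0) := by
    intro y hy
    by_cases hya : y ∈ Ioi a
    · simp only [hf, indicator_of_mem hya, smul_eq_mul]
      exact pow_finrank_sub_one_mul_rpow hy _
    · simp [hf, indicator_of_notMem hya]
  have hsub : Ioi (0 : ℝ) ∩ Ioi a = Ioi a := inter_eq_right.2 (Ioi_subset_Ioi ha.le)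
  have hint : IntegrableOn (fun y : ℝ ↦ y ^ (Module.finrank ℝ E - 1) • f y) (Ioi 0) := by
    rw [integrableOn_congr_fun hcongr measurableSet_Ioi]
    exact ((integrableOn_Ioi_rpow_of_lt (by linarith) ha).integrable_indicator
      measurableSet_Ioi).integrableOn
  have hf0 : ∀ r, 0 ≤ f r := fun r ↦ indicator_nonneg
    (fun x hx ↦ Real.rpow_nonneg (ha.le.trans (le_of_lt hx)) _) r
  have := lintegral_ofReal_fun_norm_addHaar μ hf0 hint
  rw [setIntegral_congr_fun measurableSet_Ioi hcongr, setIntegral_indicator measurableSet_Ioi,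
    hsub, integral_Ioi_rpow_of_lt (by linarith) ha, sub_add_cancel, neg_div_neg_eq] at this
  rw [← lintegral_indicator hms]
  convert this using 3 with h
  by_cases hh : a < ‖h‖ <;> simp [hf, indicator, hh]

theorem setLIntegral_norm_rpow_closedBall [Nontrivial E] (μ : Measure E)
    [μ.IsAddHaarMeasure] {β a : ℝ} (hβ : 0 < β) (ha : 0 < a) :
    ∫⁻ h in {h : E | ‖h‖ ≤ a}, ENNReal.ofReal (‖h‖ ^ (-(Module.finrank ℝ E : ℝ) + β)) ∂μ =
      ENNReal.ofReal (Module.finrank ℝ E * μ.real (ball 0 1) * (a ^ β / β)) := by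
  have hms : MeasurableSet {h : E | ‖h‖ ≤ a} := measurableSet_le measurable_norm measurable_const
  set f : ℝ → ℝ := (Icc 0 a).indicator fun r ↦ r ^ (-(Module.finrank ℝ E : ℝ) + β) with hf
  have hcongr : EqOn (fun y ↦ y ^ (Module.finrank ℝ E - 1) • f y)
      ((Ioc 0 a).indicator fun y ↦ y ^ (β - 1)) (Ioi 0) := by
    intro y hy
    by_cases hya : y ≤ a
    · simp only [hf, indicator_of_mem (show y ∈ Icc 0 a from ⟨le_of_lt hy, hya⟩),
        indicator_of_mem (show y ∈ Ioc 0 a from ⟨hy, hya⟩), smul_eq_mul]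
      exact pow_finrank_sub_one_mul_rpow hy _
    · simp [hf, indicator, hya]
  have hsub : Ioi (0 : ℝ) ∩ Ioc 0 a = Ioc 0 a := inter_eq_right.2 Ioc_subset_Ioi_self
  have hii : IntegrableOn (fun y : ℝ ↦ y ^ (β - 1)) (Ioc 0 a) :=
    (intervalIntegral.intervalIntegrable_rpow' (by linarith)).1
  have hint : IntegrableOn (fun y : ℝ ↦ y ^ (Module.finrank ℝ E - 1) • f y) (Ioi 0) := by
    rw [integrableOn_congr_fun hcongr measurableSet_Ioi]
    exact (hii.integrable_indicator measurableSet_Ioc).integrableOn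
  have hf0 : ∀ r, 0 ≤ f r := fun r ↦ indicator_nonneg
    (fun x hx ↦ Real.rpow_nonneg hx.1 _) r
  have := lintegral_ofReal_fun_norm_addHaar μ hf0 hint
  rw [setIntegral_congr_fun measurableSet_Ioi hcongr, setIntegral_indicator measurableSet_Ioc,
    hsub, ← intervalIntegral.integral_of_le ha.le, integral_rpow (Or.inl (by linarith)),
    sub_add_cancel, Real.zero_rpow hβ.ne', sub_zero] at this
  rw [← lintegral_indicator hms]
  convert this using 3 with h
  by_cases hh : ‖h‖ ≤ a <;> simp [hf, indicator, hh]

theorem lintegral_truncatedPower_norm_mul_le [Nontrivial E] (μ : Measure E) [μ.IsAddHaarMeasure]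
    {M p γ g : ℝ} (hM : 0 < M) (hp : 1 < p) (hpγ : p < γ) (hg : 0 ≤ g) :
    ∫⁻ h : E, ENNReal.ofReal (‖h‖ ^ (-(Module.finrank ℝ E : ℝ) + -p) *
      truncatedPower M γ (‖h‖ * g)) ∂μ ≤
    ENNReal.ofReal (Module.finrank ℝ E * μ.real (ball 0 1) * (1 / (γ - p) + 1 / (p - 1)) *
      M ^ (γ - p)) * ENNReal.ofReal (g ^ p) := by
  rcases hg.eq_or_lt with rfl | hg
  · simp [truncatedPower, hM.le, Real.zero_rpow (show γ ≠ 0 by linarith)]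
  have hms : MeasurableSet {h : E | ‖h‖ ≤ M / g} :=
    measurableSet_le measurable_norm measurable_const
  have hc : {h : E | ‖h‖ ≤ M / g}ᶜ = {h : E | M / g < ‖h‖} := by ext; simp
  have hγp : 0 < γ - p := by linarith
  have hp1 : 0 < p - 1 := by linarith
  rw [← lintegral_add_compl _ hms, hc]
  have h1 : ∫⁻ h : E in {h : E | ‖h‖ ≤ M / g}, ENNReal.ofReal
      (‖h‖ ^ (-(Module.finrank ℝ E : ℝ) + -p) * truncatedPower M γ (‖h‖ * g)) ∂μ ≤
      ENNReal.ofReal (g ^ γ) * ENNReal.ofReal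
        (Module.finrank ℝ E * μ.real (ball 0 1) * ((M / g) ^ (γ - p) / (γ - p))) := by
    rw [← setLIntegral_norm_rpow_closedBall μ hγp (by positivity),
      ← lintegral_const_mul _ (by fun_prop)]
    refine lintegral_mono_ae ?_
    filter_upwards [ae_restrict_mem hms, ae_restrict_of_ae (Measure.ae_ne μ 0)] with h hh h0
    have h0' : 0 < ‖h‖ := norm_pos_iff.2 h0
    rw [← ENNReal.ofReal_mul (by positivity)]
    refine ENNReal.ofReal_le_ofReal (le_of_eq ?_)
    rw [truncatedPower, if_pos ((le_div_iff₀ hg).1 hh), Real.mul_rpow h0'.le hg.le,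
      show -(Module.finrank ℝ E : ℝ) + (γ - p) = -(Module.finrank ℝ E : ℝ) + -p + γ by ring,
      Real.rpow_add h0' _ γ]
    ring
  have h2 : ∫⁻ h : E in {h : E | M / g < ‖h‖}, ENNReal.ofReal
      (‖h‖ ^ (-(Module.finrank ℝ E : ℝ) + -p) * truncatedPower M γ (‖h‖ * g)) ∂μ ≤
      ENNReal.ofReal (M ^ (γ - 1) * g) * ENNReal.ofReal
        (Module.finrank ℝ E * μ.real (ball 0 1) * ((M / g) ^ (-(p - 1)) / (p - 1))) := by
    rw [← setLIntegral_norm_rpow_compl_closedBall μ hp1 (by positivity),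
      ← lintegral_const_mul _ (by fun_prop)]
    refine lintegral_mono_ae ?_
    filter_upwards [ae_restrict_mem (hc ▸ hms.compl)] with h hh
    have h0' : 0 < ‖h‖ := lt_trans (by positivity) hh
    rw [← ENNReal.ofReal_mul (by positivity)]
    refine ENNReal.ofReal_le_ofReal (le_of_eq ?_)
    rw [truncatedPower, if_neg (not_le.2 ((div_lt_iff₀ hg).1 hh)),
      show -(Module.finrank ℝ E : ℝ) + -(p - 1) = -(Module.finrank ℝ E : ℝ) + -p + 1 by ring,
      Real.rpow_add h0' _ 1, Real.rpow_one]
    ring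
  refine (add_le_add h1 h2).trans (le_of_eq ?_)
  rw [← ENNReal.ofReal_mul (by positivity), ← ENNReal.ofReal_mul (by positivity),
    ← ENNReal.ofReal_add (by positivity) (by positivity), ← ENNReal.ofReal_mul (by positivity)]
  congr 1
  have e1 : g ^ γ * (M / g) ^ (γ - p) = M ^ (γ - p) * g ^ p := by
    rw [Real.div_rpow hM.le hg.le, Real.rpow_sub hg]
    field_simp
  have e2 : M ^ (γ - 1) * g * (M / g) ^ (-(p - 1)) = M ^ (γ - p) * g ^ p := by
    rw [Real.div_rpow hM.le hg.le, show γ - p = γ - 1 + -(p - 1) by ring, Real.rpow_add hM (γ - 1),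
      Real.rpow_neg hg.le, Real.rpow_sub_one hg.ne']
    field_simp
  linear_combination (Module.finrank ℝ E * μ.real (ball 0 1) / (γ - p)) * e1 +
    (Module.finrank ℝ E * μ.real (ball 0 1) / (p - 1)) * e2

theorem lintegral_abs_sub_rpow_le (μ : Measure E) [μ.IsAddHaarMeasure]
    {w : E → ℝ} (hw : ContDiff ℝ 1 w)
    {M γ : ℝ} (hM : ∀ x, |w x| ≤ M) (hγ : 1 < γ) (h : E) :
    ∫⁻ x, ENNReal.ofReal (|w (x + h) - w x| ^ γ) ∂μ ≤ ENNReal.ofReal (2 ^ γ) *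
      ∫⁻ x, ENNReal.ofReal (truncatedPower M γ (‖h‖ * ‖fderiv ℝ w x‖)) ∂μ := by
  have hcont : Continuous (fderiv ℝ w) := hw.continuous_fderiv one_ne_zero
  have hΦ := measurable_truncatedPower M γ
  calc _ ≤ ∫⁻ x, ENNReal.ofReal (2 ^ γ) * (∫⁻ t in Ioc (0 : ℝ) 1,
        ENNReal.ofReal (truncatedPower M γ (‖h‖ * ‖fderiv ℝ w (x + t • h)‖))) ∂μ :=
        lintegral_mono fun x ↦ ofReal_abs_sub_rpow_le_lintegral_truncatedPower hw hM hγ x h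
    _ = ENNReal.ofReal (2 ^ γ) * ∫⁻ t in Ioc (0 : ℝ) 1, ∫⁻ x,
        ENNReal.ofReal (truncatedPower M γ (‖h‖ * ‖fderiv ℝ w (x + t • h)‖)) ∂μ := by
        rw [lintegral_const_mul' _ _ ENNReal.ofReal_ne_top, lintegral_lintegral_swap]
        refine Measurable.aemeasurable (ENNReal.measurable_ofReal.comp (hΦ.comp ?_))
        exact Continuous.measurable (by fun_prop)
    _ = _ := by
        congr 1
        simp_rw [lintegral_add_right_eq_self
          (fun x ↦ ENNReal.ofReal (truncatedPower M γ (‖h‖ * ‖fderiv ℝ w x‖)))]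
        simp

theorem setLIntegral_closedBall_norm_rpow_mul_le [Nontrivial E] (μ : Measure E)
    [μ.IsAddHaarMeasure] {w : E → ℝ} (hw : ContDiff ℝ 1 w) {M p γ σ R : ℝ} (hM0 : 0 < M)
    (hM : ∀ x, |w x| ≤ M) (hp : 1 < p) (hpγ : p < γ) (hσ : σ ≤ p) (hR : 0 < R) :
    ∫⁻ h in {h : E | ‖h‖ ≤ R}, ENNReal.ofReal (‖h‖ ^ (-(Module.finrank ℝ E : ℝ) + -σ)) *
      ∫⁻ x, ENNReal.ofReal (|w (x + h) - w x| ^ γ) ∂μ ∂μ ≤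
    ENNReal.ofReal (2 ^ γ * R ^ (p - σ) *
      (Module.finrank ℝ E * μ.real (ball 0 1) * (1 / (γ - p) + 1 / (p - 1)) * M ^ (γ - p))) *
      ∫⁻ x, ENNReal.ofReal (‖fderiv ℝ w x‖ ^ p) ∂μ := by
  have hcont : Continuous (fderiv ℝ w) := hw.continuous_fderiv one_ne_zero
  have hΦ := measurable_truncatedPower M γ
  have hms : MeasurableSet {h : E | ‖h‖ ≤ R} := measurableSet_le measurable_norm measurable_const
  calc _ ≤ ∫⁻ h in {h : E | ‖h‖ ≤ R}, ENNReal.ofReal (2 ^ γ * R ^ (p - σ)) *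
        ∫⁻ x, ENNReal.ofReal (‖h‖ ^ (-(Module.finrank ℝ E : ℝ) + -p) *
          truncatedPower M γ (‖h‖ * ‖fderiv ℝ w x‖)) ∂μ ∂μ := by
        refine lintegral_mono_ae ?_
        filter_upwards [ae_restrict_mem hms, ae_restrict_of_ae (Measure.ae_ne μ 0)] with h hh h0
        have h0' : 0 < ‖h‖ := norm_pos_iff.2 h0
        have hk : ‖h‖ ^ (-(Module.finrank ℝ E : ℝ) + -σ) ≤
            R ^ (p - σ) * ‖h‖ ^ (-(Module.finrank ℝ E : ℝ) + -p) := by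
          rw [show -(Module.finrank ℝ E : ℝ) + -σ = p - σ + (-(Module.finrank ℝ E : ℝ) + -p) by
            ring, Real.rpow_add h0']
          gcongr
        calc _ ≤ ENNReal.ofReal (R ^ (p - σ) * ‖h‖ ^ (-(Module.finrank ℝ E : ℝ) + -p)) *
              (ENNReal.ofReal (2 ^ γ) *
                ∫⁻ x, ENNReal.ofReal (truncatedPower M γ (‖h‖ * ‖fderiv ℝ w x‖)) ∂μ) := by
              gcongr
              exact lintegral_abs_sub_rpow_le μ hw hM (hp.trans hpγ) h
          _ = _ := by
              simp_rw [ENNReal.ofReal_mul (show 0 ≤ ‖h‖ ^ (-(Module.finrank ℝ E : ℝ) + -p) by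
                positivity)]
              rw [lintegral_const_mul' _ _ ENNReal.ofReal_ne_top,
                ENNReal.ofReal_mul (by positivity), ENNReal.ofReal_mul (by positivity)]
              ring
    _ ≤ ∫⁻ h, ENNReal.ofReal (2 ^ γ * R ^ (p - σ)) *
        ∫⁻ x, ENNReal.ofReal (‖h‖ ^ (-(Module.finrank ℝ E : ℝ) + -p) *
          truncatedPower M γ (‖h‖ * ‖fderiv ℝ w x‖)) ∂μ ∂μ := setLIntegral_le_lintegral _ _
    _ = ENNReal.ofReal (2 ^ γ * R ^ (p - σ)) *
        ∫⁻ x, ∫⁻ h, ENNReal.ofReal (‖h‖ ^ (-(Module.finrank ℝ E : ℝ) + -p) *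
          truncatedPower M γ (‖h‖ * ‖fderiv ℝ w x‖)) ∂μ ∂μ := by
        rw [lintegral_const_mul' _ _ ENNReal.ofReal_ne_top, lintegral_lintegral_swap]
        refine Measurable.aemeasurable (ENNReal.measurable_ofReal.comp (Measurable.mul ?_
          (hΦ.comp ?_)))
        · fun_prop
        · exact Continuous.measurable (by fun_prop)
    _ ≤ ENNReal.ofReal (2 ^ γ * R ^ (p - σ)) * ∫⁻ x, ENNReal.ofReal
        (Module.finrank ℝ E * μ.real (ball 0 1) * (1 / (γ - p) + 1 / (p - 1)) * M ^ (γ - p)) *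
          ENNReal.ofReal (‖fderiv ℝ w x‖ ^ p) ∂μ := by
        gcongr with x
        exact lintegral_truncatedPower_norm_mul_le μ hM0 hp hpγ (norm_nonneg _)
    _ = _ := by
        rw [lintegral_const_mul' _ _ ENNReal.ofReal_ne_top, ← mul_assoc,
          ← ENNReal.ofReal_mul (by positivity)]

theorem setLIntegral_compl_closedBall_norm_rpow_mul_le [Nontrivial E] (μ : Measure E)
    [μ.IsAddHaarMeasure] {w : E → ℝ} {M γ σ R : ℝ} (hM : ∀ x, |w x| ≤ M) (hγ : 0 ≤ γ)
    (hσ : 0 < σ) (hR : 0 < R) (B : Set E) :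
    ∫⁻ h in {h : E | R < ‖h‖}, ENNReal.ofReal (‖h‖ ^ (-(Module.finrank ℝ E : ℝ) + -σ)) *
      ∫⁻ x in B, ENNReal.ofReal (|w (x + h) - w x| ^ γ) ∂μ ∂μ ≤
    ENNReal.ofReal ((2 * M) ^ γ * (Module.finrank ℝ E * μ.real (ball 0 1) * (R ^ (-σ) / σ))) *
      μ B := by
  have hM0 : 0 ≤ M := (abs_nonneg _).trans (hM 0)
  calc _ ≤ ∫⁻ h in {h : E | R < ‖h‖}, ENNReal.ofReal (‖h‖ ^ (-(Module.finrank ℝ E : ℝ) + -σ)) *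
        ∫⁻ x in B, ENNReal.ofReal ((2 * M) ^ γ) ∂μ ∂μ := by
        gcongr with h x
        exact (abs_sub _ _).trans (by linarith [hM (x + h), hM x])
    _ = _ := by
        rw [lintegral_mul_const _ (by fun_prop), setLIntegral_norm_rpow_compl_closedBall μ hσ hR,
          setLIntegral_const, ENNReal.ofReal_mul (p := (2 * M) ^ γ) (by positivity)]
        ring

theorem enorm_gagliardo_integral_le (μ : Measure E) [μ.IsAddHaarMeasure] {w : E → ℝ}
    (hw : Continuous w) (γ σ : ℝ) (B : Set E) :
    ‖∫ x in B, ∫ y in B, |w x - w y| ^ γ / ‖x - y‖ ^ ((Module.finrank ℝ E : ℝ) + σ) ∂μ ∂μ‖ₑ ≤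
      ∫⁻ h, ENNReal.ofReal (‖h‖ ^ (-(Module.finrank ℝ E : ℝ) + -σ)) *
        ∫⁻ x in B, ENNReal.ofReal (|w (x + h) - w x| ^ γ) ∂μ ∂μ := by
  set F : E → E → ENNReal := fun x h ↦ ENNReal.ofReal (‖h‖ ^ (-(Module.finrank ℝ E : ℝ) + -σ)) *
    ENNReal.ofReal (|w (x + h) - w x| ^ γ) with hF
  calc _ ≤ ∫⁻ x in B, ∫⁻ y in B, F x (-x + y) ∂μ ∂μ := by
        refine (enorm_integral_le_lintegral_enorm _).trans (lintegral_mono fun x ↦ ?_)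
        refine (enorm_integral_le_lintegral_enorm _).trans (lintegral_mono fun y ↦ ?_)
        simp only [hF]
        rw [← ENNReal.ofReal_mul (by positivity), Real.enorm_eq_ofReal (by positivity)]
        refine ENNReal.ofReal_le_ofReal (le_of_eq ?_)
        rw [neg_add_eq_sub, norm_sub_rev, add_sub_cancel, abs_sub_comm, ← neg_add,
          Real.rpow_neg (norm_nonneg _)]
        ring
    _ ≤ ∫⁻ x in B, ∫⁻ y, F x (-x + y) ∂μ ∂μ := by
        gcongr
        exact Measure.restrict_le_self
    _ = ∫⁻ x in B, ∫⁻ h, F x h ∂μ ∂μ := by simp_rw [lintegral_add_left_eq_self]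
    _ = ∫⁻ h, ∫⁻ x in B, F x h ∂μ ∂μ := by
        refine lintegral_lintegral_swap (Measurable.aemeasurable ?_)
        have : Measurable fun z : E × E ↦ w (z.1 + z.2) - w z.1 :=
          Continuous.measurable (by fun_prop)
        simp only [hF, Function.uncurry_def]
        fun_prop
    _ = _ := by simp_rw [hF, lintegral_const_mul' _ _ ENNReal.ofReal_ne_top]

theorem gagliardo_integral_le [Nontrivial E] (μ : Measure E) [μ.IsAddHaarMeasure] {w : E → ℝ}
    (hw : ContDiff ℝ 1 w) (hwc : HasCompactSupport w) {B : Set E} (hB : μ B ≠ ⊤)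
    (hwB : tsupport w ⊆ B) {M p γ σ R : ℝ} (hM0 : 0 < M) (hM : ∀ x, |w x| ≤ M) (hp : 1 < p)
    (hpγ : p < γ) (hσ0 : 0 < σ) (hσ : σ ≤ p) (hR : 0 < R) :
    ∫ x in B, ∫ y in B, |w x - w y| ^ γ / ‖x - y‖ ^ ((Module.finrank ℝ E : ℝ) + σ) ∂μ ∂μ ≤
      2 ^ γ * R ^ (p - σ) *
        (Module.finrank ℝ E * μ.real (ball 0 1) * (1 / (γ - p) + 1 / (p - 1)) * M ^ (γ - p)) *
        ∫ x in B, ‖fderiv ℝ w x‖ ^ p ∂μ +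
      (2 * M) ^ γ * (Module.finrank ℝ E * μ.real (ball 0 1) * (R ^ (-σ) / σ)) * μ.real B := by
  have hcont : Continuous (fderiv ℝ w) := hw.continuous_fderiv one_ne_zero
  have hms : MeasurableSet {h : E | ‖h‖ ≤ R} := measurableSet_le measurable_norm measurable_const
  have hc : {h : E | ‖h‖ ≤ R}ᶜ = {h : E | R < ‖h‖} := by ext; simp
  have hp0 : 0 < p := by linarith
  have hint : Integrable (fun x ↦ ‖fderiv ℝ w x‖ ^ p) μ := by
    refine Continuous.integrable_of_hasCompactSupport
      (hcont.norm.rpow_const fun _ ↦ Or.inr hp0.le) ?_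
    exact (hwc.fderiv ℝ).comp_left (g := fun L : E →L[ℝ] ℝ ↦ ‖L‖ ^ p)
      (by simp [Real.zero_rpow hp0.ne'])
  have hP : ∫⁻ x, ENNReal.ofReal (‖fderiv ℝ w x‖ ^ p) ∂μ =
      ENNReal.ofReal (∫ x in B, ‖fderiv ℝ w x‖ ^ p ∂μ) := by
    rw [← ofReal_integral_eq_lintegral_ofReal hint (.of_forall fun x ↦ by positivity),
      setIntegral_eq_integral_of_forall_compl_eq_zero]
    intro x hx
    rw [fderiv_of_notMem_tsupport ℝ (fun h ↦ hx (hwB h)), norm_zero, Real.zero_rpow hp0.ne']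
  have hP0 : 0 ≤ ∫ x in B, ‖fderiv ℝ w x‖ ^ p ∂μ := integral_nonneg fun x ↦ by positivity
  have hγp : 0 < γ - p := by linarith
  have hp1 : 0 < p - 1 := by linarith
  refine (ENNReal.ofReal_le_ofReal_iff (by positivity)).1 ?_
  refine (Real.ofReal_le_enorm _).trans
    ((enorm_gagliardo_integral_le μ hw.continuous γ σ B).trans ?_)
  rw [← lintegral_add_compl _ hms, hc, ENNReal.ofReal_add (by positivity) (by positivity)]
  refine add_le_add ?_ ?_
  · rw [ENNReal.ofReal_mul (by positivity), ← hP]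
    refine le_trans ?_ (setLIntegral_closedBall_norm_rpow_mul_le μ hw hM0 hM hp hpγ hσ hR)
    gcongr
    exact Measure.restrict_le_self
  · rw [ENNReal.ofReal_mul (by positivity), ofReal_measureReal hB]
    exact setLIntegral_compl_closedBall_norm_rpow_mul_le μ hM (by linarith) hσ0 hR B

end


/-- **Localized interpolation estimate.** For `n ≥ 1`, `s ∈ (0,1)`, `1 < p < γ ≤ p/s`,
there is a constant `c = c(n,p,s,γ) > 0` such that for every ball `B_ρ ⊂ ℝⁿ` and every
`C¹` function `w : ℝⁿ → ℝ` with compact support contained in `B_ρ`,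
`(|B_ρ|⁻¹ ∬_{B_ρ×B_ρ} |w(x)-w(y)|^γ/|x-y|^{n+sγ})^{1/γ}
  ≤ c (sup_{B_ρ}|w|)^{1-s} (⨍_{B_ρ} |Dw|^p)^{s/p}`. -/
theorem localized_interpolation
    (n : ℕ) (hn : 1 ≤ n) (p γ s : ℝ) (hs : s ∈ Set.Ioo (0 : ℝ) 1)
    (hp : 1 < p) (hpγ : p < γ) (hγ : γ ≤ p / s) :
    ∃ c : ℝ, 0 < c ∧
      ∀ (x₀ : EuclideanSpace ℝ (Fin n)) (ρ : ℝ), 0 < ρ →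
        ∀ w : EuclideanSpace ℝ (Fin n) → ℝ,
          ContDiff ℝ 1 w → HasCompactSupport w → tsupport w ⊆ ball x₀ ρ →
          ((volume (ball x₀ ρ)).toReal⁻¹ *
              ∫ x in ball x₀ ρ, ∫ y in ball x₀ ρ,
                |w x - w y| ^ γ / ‖x - y‖ ^ ((n : ℝ) + s * γ)) ^ (1 / γ) ≤
            c * (⨆ x ∈ ball x₀ ρ, |w x|) ^ (1 - s) *
              (⨍ x in ball x₀ ρ, ‖fderiv ℝ w x‖ ^ p) ^ (s / p) := by
  have hE : Module.finrank ℝ (EuclideanSpace ℝ (Fin n)) = n := finrank_euclideanSpace_fin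
  have : Nonempty (Fin n) := ⟨⟨0, hn⟩⟩
  obtain ⟨hs0, hs1⟩ := hs
  have hp0 : 0 < p := by linarith
  have hγ0 : 0 < γ := by linarith
  have hp1 : 0 < p - 1 := by linarith
  have hγp : 0 < γ - p := by linarith
  have hσ0 : 0 < s * γ := by positivity
  have hσ : s * γ ≤ p := by rwa [le_div_iff₀ hs0, mul_comm] at hγ
  set A : ℝ := n * volume.real (ball (0 : EuclideanSpace ℝ (Fin n)) 1) with hA
  have hA0 : 0 < A := mul_pos (by exact_mod_cast hn)
    (ENNReal.toReal_pos (measure_ball_pos _ _ one_pos).ne' measure_ball_lt_top.ne)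
  set C : ℝ := 2 ^ γ * A * (1 / (γ - p) + 1 / (p - 1) + 1 / (s * γ)) with hC
  have hC0 : 0 < C := by positivity
  refine ⟨C ^ (1 / γ), by positivity, fun x₀ ρ hρ w hw hwc hwB ↦ ?_⟩
  set B := ball x₀ ρ with hB
  set M := ⨆ x ∈ B, |w x| with hMdef
  set V := (volume B).toReal with hV
  have hV0 : 0 < V := ENNReal.toReal_pos (measure_ball_pos _ _ hρ).ne' measure_ball_lt_top.ne
  set G := ⨍ x in B, ‖fderiv ℝ w x‖ ^ p with hG
  have hGV : ∫ x in B, ‖fderiv ℝ w x‖ ^ p = V * G := by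
    rw [hG, setAverage_eq, smul_eq_mul, measureReal_def, mul_inv_cancel_left₀ hV0.ne']
  have hG0 : 0 ≤ G := by
    rw [hG, setAverage_eq]
    exact smul_nonneg (by positivity) (integral_nonneg fun x ↦ by positivity)
  have hM0 : 0 ≤ M := Real.iSup_nonneg fun x ↦ Real.iSup_nonneg fun _ ↦ abs_nonneg _
  have hM (x) : |w x| ≤ M := by
    by_cases hx : x ∈ B
    · obtain ⟨K, hK⟩ := hwc.exists_bound_of_continuous hw.continuous
      have hK0 : 0 ≤ K := (norm_nonneg _).trans (hK x)
      have hbdd : BddAbove (range fun x ↦ ⨆ _ : x ∈ B, |w x|) :=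
        ⟨K, forall_mem_range.2 fun y ↦ Real.iSup_le (fun _ ↦ hK y) hK0⟩
      refine le_trans ?_ (le_ciSup hbdd x)
      simp [hx]
    · rw [image_eq_zero_of_notMem_tsupport fun h ↦ hx (hwB h), abs_zero]
      exact hM0
  have hconst (h : ∀ x y, w x = w y) :
      (V⁻¹ * ∫ x in B, ∫ y in B, |w x - w y| ^ γ / ‖x - y‖ ^ ((n : ℝ) + s * γ)) ^ (1 / γ) ≤
        C ^ (1 / γ) * M ^ (1 - s) * G ^ (s / p) := by
    have hz (x y) : |w x - w y| ^ γ / ‖x - y‖ ^ ((n : ℝ) + s * γ) = 0 := by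
      rw [h x y, sub_self, abs_zero, Real.zero_rpow hγ0.ne', zero_div]
    simp only [hz, integral_zero, mul_zero]
    rw [Real.zero_rpow (by positivity)]
    positivity
  rcases hM0.eq_or_lt with hM0' | hMpos
  · have hw0 (x) : w x = 0 := by simpa [← hM0'] using hM x
    exact hconst fun x y ↦ by rw [hw0, hw0]
  rcases hG0.eq_or_lt with hG0' | hGpos
  · refine hconst (is_const_of_fderiv_eq_zero (hw.differentiable one_ne_zero) fun x ↦ ?_)
    by_contra hx
    have hcont : Continuous fun x ↦ ‖fderiv ℝ w x‖ ^ p :=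
      (hw.continuous_fderiv one_ne_zero).norm.rpow_const fun _ ↦ Or.inr hp0.le
    have hpos : 0 < ∫ x, ‖fderiv ℝ w x‖ ^ p :=
      hcont.integral_pos_of_hasCompactSupport_nonneg_nonzero
        ((hwc.fderiv ℝ).comp_left (g := fun L : EuclideanSpace ℝ (Fin n) →L[ℝ] ℝ ↦ ‖L‖ ^ p)
          (by simp [Real.zero_rpow hp0.ne']))
        (fun x ↦ by positivity) (x := x) (Real.rpow_pos_of_pos (norm_pos_iff.2 hx) p).ne'
    rw [← setIntegral_eq_integral_of_forall_compl_eq_zero (s := B), hGV, ← hG0', mul_zero] at hpos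
    · exact hpos.false
    · intro y hy
      rw [fderiv_of_notMem_tsupport ℝ fun h ↦ hy (hwB h), norm_zero, Real.zero_rpow hp0.ne']
  have hR : 0 < M / G ^ (1 / p) := by positivity
  have key := gagliardo_integral_le volume hw hwc (B := B) measure_ball_lt_top.ne hwB hMpos hM hp
    hpγ hσ0 hσ hR
  rw [hE, hGV, measureReal_def (s := B), ← hA, ← hV] at key
  set I := ∫ x in B, ∫ y in B, |w x - w y| ^ γ / ‖x - y‖ ^ ((n : ℝ) + s * γ)
  have hI0 : 0 ≤ I := integral_nonneg fun x ↦ integral_nonneg fun y ↦ by positivity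
  have e1 : (M / G ^ (1 / p)) ^ (p - s * γ) * M ^ (γ - p) * G =
      M ^ ((1 - s) * γ) * G ^ (s / p * γ) := by
    rw [Real.div_rpow hM0 (by positivity), ← Real.rpow_mul hG0,
      show (1 - s) * γ = p - s * γ + (γ - p) by ring, Real.rpow_add hMpos,
      show 1 / p * (p - s * γ) = 1 - s / p * γ by field_simp, Real.rpow_sub hGpos, Real.rpow_one]
    field_simp
  have e2 : M ^ γ * (M / G ^ (1 / p)) ^ (-(s * γ)) = M ^ ((1 - s) * γ) * G ^ (s / p * γ) := by
    rw [Real.div_rpow hM0 (by positivity), ← Real.rpow_mul hG0,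
      show (1 - s) * γ = γ + -(s * γ) by ring, Real.rpow_add hMpos,
      show 1 / p * -(s * γ) = -(s / p * γ) by ring, Real.rpow_neg hG0]
    field_simp
  have hIle : V⁻¹ * I ≤ C * (M ^ ((1 - s) * γ) * G ^ (s / p * γ)) := by
    rw [inv_mul_le_iff₀ hV0]
    refine key.trans (le_of_eq ?_)
    rw [Real.mul_rpow two_pos.le hM0, hC]
    linear_combination (2 ^ γ * A * (1 / (γ - p) + 1 / (p - 1)) * V) * e1 +
      (2 ^ γ * A / (s * γ) * V) * e2
  calc (V⁻¹ * I) ^ (1 / γ) ≤ (C * (M ^ ((1 - s) * γ) * G ^ (s / p * γ))) ^ (1 / γ) := by gcongr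
    _ = _ := by
      rw [Real.mul_rpow hC0.le (by positivity),
        Real.mul_rpow (x := M ^ ((1 - s) * γ)) (by positivity) (by positivity),
        ← Real.rpow_mul hM0, ← Real.rpow_mul hG0, mul_one_div, mul_one_div,
        mul_div_cancel_right₀ _ hγ0.ne', mul_div_cancel_right₀ _ hγ0.ne', mul_assoc]
end

section
/- Unified embedding/interpolation estimate: Let n ≥ 1 be an integer, p, γ > 1, s ∈ (0,1) with sγ ≤ p, and set ϑ := s if γ > p and ϑ := 1 if γ ≤ p. Let B_ρ ⊂ ℝⁿ be an open ball of radius ρ > 0. There is a constant c = c(n, p, s, γ) > 0 such that for every continuously differentiable function w : ℝⁿ → ℝ whose support is a compact subset of B_ρ, one has ( |B_ρ|⁻¹ ∬_{B_ρ×B_ρ} |w(x) − w(y)|^γ / |x−y|^{n+sγ} dx dy )^{1/γ} ≤ c (sup_{B_ρ}|w|)^{1−ϑ} ρ^{ϑ−s} ( |B_ρ|⁻¹ ∫_{B_ρ} |Dw|^p dx )^{ϑ/p}, where (sup_{B_ρ}|w|)^{1−ϑ} is interpreted as 1 when ϑ = 1. -/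
open MeasureTheory Metric Set

open scoped ENNReal

section MaximalFunction

variable {E : Type*} [NormedAddCommGroup E] [MeasurableSpace E]

/-- The centered Hardy-Littlewood maximal function over rational radii at most `R`. -/
noncomputable def truncatedMaximal (μ : Measure E) (R : ℝ) (g : E → ℝ≥0∞) (x : E) : ℝ≥0∞ :=
  ⨆ q : {q : ℚ // 0 < q ∧ (q : ℝ) ≤ R}, (μ (ball x (q : ℚ)))⁻¹ * ∫⁻ y in ball x (q : ℚ), g y ∂μ

theorem truncatedMaximal_mono (μ : Measure E) (R : ℝ) {f g : E → ℝ≥0∞} (h : f ≤ g) (x : E) :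
    truncatedMaximal μ R f x ≤ truncatedMaximal μ R g x :=
  iSup_mono fun _ => by gcongr; exact h _

variable [NormedSpace ℝ E] [FiniteDimensional ℝ E]
  (μ : Measure E) [μ.IsAddHaarMeasure]

theorem truncatedMaximal_const_le (R : ℝ) (c : ℝ≥0∞) (x : E) :
    truncatedMaximal μ R (fun _ => c) x ≤ c := by
  refine iSup_le fun q => ?_
  have hq : (0 : ℝ) < (q : ℚ) := by exact_mod_cast q.2.1
  rw [setLIntegral_const, mul_comm c, ← mul_assoc,
    ENNReal.inv_mul_cancel (measure_ball_pos μ x hq).ne' measure_ball_lt_top.ne, one_mul]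

theorem truncatedMaximal_ofReal_le (R : ℝ) {g : E → ℝ} {N : ℝ} (hN : ∀ x, g x ≤ N) (x : E) :
    truncatedMaximal μ R (fun y => ENNReal.ofReal (g y)) x ≤ ENNReal.ofReal N :=
  (truncatedMaximal_mono μ R (fun y => ENNReal.ofReal_le_ofReal (hN y)) x).trans
    (truncatedMaximal_const_le μ R _ x)

theorem truncatedMaximal_add_const_le (R : ℝ) (g : E → ℝ≥0∞) (c : ℝ≥0∞) (x : E) :
    truncatedMaximal μ R (fun y => g y + c) x ≤ truncatedMaximal μ R g x + c := by
  refine iSup_le fun q => ?_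
  rw [lintegral_add_right _ measurable_const, mul_add]
  gcongr
  · exact le_iSup (fun q : {q : ℚ // 0 < q ∧ (q : ℝ) ≤ R} =>
      (μ (ball x (q : ℚ)))⁻¹ * ∫⁻ y in ball x (q : ℚ), g y ∂μ) q
  · exact (le_iSup (fun q : {q : ℚ // 0 < q ∧ (q : ℝ) ≤ R} =>
      (μ (ball x (q : ℚ)))⁻¹ * ∫⁻ _ in ball x (q : ℚ), c ∂μ) q).trans
      (truncatedMaximal_const_le μ R c x)

variable [BorelSpace E]

theorem measurable_setLIntegral_ball {g : E → ℝ≥0∞} (hg : Measurable g) (r : ℝ) :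
    Measurable fun x => ∫⁻ y in ball x r, g y ∂μ := by
  have h : ∀ x, ∫⁻ y in ball x r, g y ∂μ = ∫⁻ y, (ball x r).indicator g y ∂μ :=
    fun x => (lintegral_indicator measurableSet_ball g).symm
  simp_rw [h]
  refine Measurable.lintegral_prod_right' (f := fun z : E × E => (ball z.1 r).indicator g z.2) ?_
  have hset : MeasurableSet {z : E × E | dist z.2 z.1 < r} :=
    (isOpen_lt (by fun_prop) continuous_const).measurableSet
  exact (hg.comp measurable_snd).indicator hset

theorem measurable_truncatedMaximal (R : ℝ) {g : E → ℝ≥0∞} (hg : Measurable g) :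
    Measurable (truncatedMaximal μ R g) := by
  refine Measurable.iSup fun q => ?_
  simp_rw [Measure.addHaar_ball_center μ _ ((q : ℚ) : ℝ)]
  exact (measurable_setLIntegral_ball μ hg _).const_mul _

theorem setLIntegral_ball_le_truncatedMaximal {R r : ℝ} (hr : 0 < r) (hrR : r < R)
    (g : E → ℝ≥0∞) (x : E) :
    ∫⁻ y in ball x r, g y ∂μ ≤
      2 ^ Module.finrank ℝ E * μ (ball x r) * truncatedMaximal μ R g x := by
  obtain ⟨q, hq1, hq2⟩ := exists_rat_btwn (lt_min hrR (by linarith : r < 2 * r))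
  have hq0 : (0 : ℝ) < q := hr.trans hq1
  have hle : (μ (ball x q))⁻¹ * ∫⁻ y in ball x q, g y ∂μ ≤ truncatedMaximal μ R g x :=
    le_iSup (fun q : {q : ℚ // 0 < q ∧ (q : ℝ) ≤ R} =>
      (μ (ball x (q : ℚ)))⁻¹ * ∫⁻ y in ball x (q : ℚ), g y ∂μ)
      ⟨q, by exact_mod_cast hq0, (hq2.trans_le (min_le_left _ _)).le⟩
  calc ∫⁻ y in ball x r, g y ∂μ
      ≤ ∫⁻ y in ball x q, g y ∂μ := lintegral_mono_set (ball_subset_ball hq1.le)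
    _ = μ (ball x q) * ((μ (ball x q))⁻¹ * ∫⁻ y in ball x q, g y ∂μ) := by
        rw [← mul_assoc, ENNReal.mul_inv_cancel (measure_ball_pos μ x hq0).ne'
          measure_ball_lt_top.ne, one_mul]
    _ ≤ μ (ball x (2 * r)) * truncatedMaximal μ R g x := by
        gcongr
        exact (hq2.trans_le (min_le_right _ _)).le
    _ = _ := by
        rw [Measure.addHaar_ball_mul_of_pos μ x two_pos, Measure.addHaar_ball_center μ x r,
          ENNReal.ofReal_pow zero_le_two, ENNReal.ofReal_ofNat]

/-- The weak type `(1,1)` inequality for the maximal function. -/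
theorem mul_measure_lt_truncatedMaximal_le (R : ℝ) (g : E → ℝ≥0∞) (t : ℝ≥0∞) :
    t * μ {x | t < truncatedMaximal μ R g x} ≤ 4 ^ Module.finrank ℝ E * ∫⁻ y, g y ∂μ := by
  set S := {x | t < truncatedMaximal μ R g x}
  have hS : ∀ x : S, ∃ q : {q : ℚ // 0 < q ∧ (q : ℝ) ≤ R},
      t < (μ (ball (x : E) (q : ℚ)))⁻¹ * ∫⁻ y in ball (x : E) (q : ℚ), g y ∂μ :=
    fun x => lt_iSup_iff.1 x.2
  choose q hq using hS
  have hq0 : ∀ x, (0 : ℝ) < (q x : ℚ) := fun x => by exact_mod_cast (q x).2.1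
  obtain ⟨u, -, hdisj, hcov⟩ := Vitali.exists_disjoint_subfamily_covering_enlargement_ball
    (univ : Set S) (fun x => (x : E)) (fun x => ((q x : ℚ) : ℝ)) R (fun x _ => (q x).2.2) 4
    (by norm_num)
  have hu : u.Countable := hdisj.countable_of_isOpen (fun _ _ => isOpen_ball)
    fun x _ => nonempty_ball.2 (hq0 x)
  have hsub : S ⊆ ⋃ x ∈ u, ball (x : E) (4 * (q x : ℚ)) := fun x hx => by
    obtain ⟨b, hb, hxb⟩ := hcov ⟨x, hx⟩ (mem_univ _)
    exact mem_biUnion hb (hxb (mem_ball_self (hq0 _)))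
  have hball : ∀ x : S, t * μ (ball (x : E) (q x : ℚ)) ≤ ∫⁻ y in ball (x : E) (q x : ℚ), g y ∂μ :=
    fun x => by
      have h := mul_le_mul_left (hq x).le (μ (ball (x : E) (q x : ℚ)))
      rwa [mul_comm (_)⁻¹, mul_assoc, ENNReal.inv_mul_cancel (measure_ball_pos μ _ (hq0 x)).ne'
        measure_ball_lt_top.ne, mul_one] at h
  have : Countable u := hu.to_subtype
  calc t * μ S ≤ t * ∑' x : u, μ (ball ((x : S) : E) (4 * (q x : ℚ))) := by
        gcongr
        refine (measure_mono hsub).trans ?_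
        rw [biUnion_eq_iUnion]
        exact measure_iUnion_le _
    _ = 4 ^ Module.finrank ℝ E * ∑' x : u, t * μ (ball ((x : S) : E) (q x : ℚ)) := by
        rw [← ENNReal.tsum_mul_left, ← ENNReal.tsum_mul_left]
        refine tsum_congr fun x => ?_
        rw [Measure.addHaar_ball_mul_of_pos μ _ four_pos, Measure.addHaar_ball_center μ (x : E) _,
          ENNReal.ofReal_pow (by norm_num), ENNReal.ofReal_ofNat, mul_left_comm]
    _ ≤ 4 ^ Module.finrank ℝ E * ∑' x : u, ∫⁻ y in ball ((x : S) : E) (q x : ℚ), g y ∂μ := by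
        gcongr with x
        exact hball x
    _ = 4 ^ Module.finrank ℝ E *
          ∫⁻ y in ⋃ x : u, ball ((x : S) : E) (q (x : S) : ℚ), g y ∂μ := by
        rw [lintegral_iUnion (fun _ => measurableSet_ball)]
        exact fun x y hxy => hdisj x.2 y.2 (Subtype.coe_injective.ne hxy)
    _ ≤ _ := by
        gcongr
        exact Measure.restrict_le_self

end MaximalFunction

section PowerIntegrals

theorem lintegral_Ioo_rpow_sub_one {a b : ℝ} (ha : 0 < a) (hb : 0 ≤ b) :
    ∫⁻ t in Ioo 0 b, ENNReal.ofReal (t ^ (a - 1)) = ENNReal.ofReal (b ^ a / a) := by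
  rw [setLIntegral_congr Ioo_ae_eq_Ioc, ← ofReal_integral_eq_lintegral_ofReal,
    ← intervalIntegral.integral_of_le hb, integral_rpow (Or.inl (by linarith))]
  · simp [Real.zero_rpow ha.ne']
  · exact (intervalIntegral.intervalIntegrable_rpow' (by linarith)).1
  · filter_upwards [ae_restrict_mem measurableSet_Ioc] with t ht using Real.rpow_nonneg ht.1.le _

theorem lintegral_Ioi_rpow_neg_sub_one {a b : ℝ} (ha : 0 < a) (hb : 0 < b) :
    ∫⁻ t in Ioi b, ENNReal.ofReal (t ^ (-a - 1)) = ENNReal.ofReal (b ^ (-a) / a) := by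
  rw [← ofReal_integral_eq_lintegral_ofReal, integral_Ioi_rpow_of_lt (by linarith) hb]
  · simp [neg_div_neg_eq]
  · exact integrableOn_Ioi_rpow_of_lt (by linarith) hb
  · filter_upwards [ae_restrict_mem measurableSet_Ioi] with t ht
      using Real.rpow_nonneg (hb.trans ht).le _

variable {E : Type*} [NormedAddCommGroup E] [NormedSpace ℝ E] [FiniteDimensional ℝ E]
  [MeasurableSpace E] [BorelSpace E] [Nontrivial E] (μ : Measure E) [μ.IsAddHaarMeasure]

theorem lintegral_fun_norm_addHaar {f : ℝ → ℝ≥0∞} (hf : Measurable f) :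
    ∫⁻ x, f ‖x‖ ∂μ = Module.finrank ℝ E * μ (ball 0 1) *
      ∫⁻ y in Ioi (0 : ℝ), ENNReal.ofReal (y ^ (Module.finrank ℝ E - 1)) * f y :=
  calc
    ∫⁻ x, f ‖x‖ ∂μ = ∫⁻ x : ({(0)}ᶜ : Set E), f ‖x.1‖ ∂(μ.comap (↑)) := by
      rw [lintegral_subtype_comap (measurableSet_singleton _).compl fun x ↦ f ‖x‖,
        restrict_compl_singleton]
    _ = ∫⁻ x, f x.2 ∂μ.toSphere.prod (.volumeIoiPow (Module.finrank ℝ E - 1)) := by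
      simpa using μ.measurePreserving_homeomorphUnitSphereProd.lintegral_comp_emb
        (Homeomorph.measurableEmbedding _) (f ∘ Subtype.val ∘ Prod.snd)
    _ = μ.toSphere univ *
          ∫⁻ x : Ioi (0 : ℝ), f x ∂.volumeIoiPow (Module.finrank ℝ E - 1) := by
      rw [lintegral_prod _ (by fun_prop)]
      simp only [lintegral_const, mul_comm]
    _ = _ := by
      rw [μ.toSphere_apply_univ, Measure.volumeIoiPow,
        lintegral_withDensity_eq_lintegral_mul _ (by fun_prop) (by fun_prop)]
      congr 1
      exact lintegral_subtype_comap measurableSet_Ioi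
        fun y : ℝ => ENNReal.ofReal (y ^ (Module.finrank ℝ E - 1)) * f y

theorem ofReal_pow_mul_ofReal_rpow {d : ℕ} (hd : 0 < d) {a y : ℝ} (hy : 0 < y) :
    ENNReal.ofReal (y ^ (d - 1)) * ENNReal.ofReal (y ^ (a - d)) =
      ENNReal.ofReal (y ^ (a - 1)) := by
  rw [← ENNReal.ofReal_mul (by positivity), ← Real.rpow_natCast, ← Real.rpow_add hy,
    Nat.cast_sub hd]
  congr 2
  push_cast
  ring

theorem setLIntegral_ball_norm_rpow {a δ : ℝ} (ha : 0 < a) (hδ : 0 ≤ δ) :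
    ∫⁻ h in ball (0 : E) δ, ENNReal.ofReal (‖h‖ ^ (a - Module.finrank ℝ E)) ∂μ =
      Module.finrank ℝ E * μ (ball 0 1) * ENNReal.ofReal (δ ^ a / a) := by
  have hm : Measurable ((Iio δ).indicator fun y : ℝ =>
      ENNReal.ofReal (y ^ (a - Module.finrank ℝ E))) :=
    Measurable.indicator (by fun_prop) measurableSet_Iio
  have h := lintegral_fun_norm_addHaar μ hm
  rw [← lintegral_Ioo_rpow_sub_one ha hδ, ← lintegral_indicator measurableSet_ball]
  convert h using 2
  · ext x
    simp [indicator]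
  · rw [← lintegral_indicator measurableSet_Ioo, ← lintegral_indicator measurableSet_Ioi]
    congr 1
    ext y
    by_cases hy : 0 < y
    · by_cases hyδ : y < δ
      · simp [hy, hyδ, ofReal_pow_mul_ofReal_rpow Module.finrank_pos hy]
      · simp [indicator, hyδ]
    · simp [hy]

theorem setLIntegral_compl_ball_norm_rpow {b δ : ℝ} (hb : 0 < b) (hδ : 0 < δ) :
    ∫⁻ h in (ball (0 : E) δ)ᶜ, ENNReal.ofReal (‖h‖ ^ (-b - Module.finrank ℝ E)) ∂μ =
      Module.finrank ℝ E * μ (ball 0 1) * ENNReal.ofReal (δ ^ (-b) / b) := by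
  have hm : Measurable ((Ici δ).indicator fun y : ℝ =>
      ENNReal.ofReal (y ^ (-b - Module.finrank ℝ E))) :=
    Measurable.indicator (by fun_prop) measurableSet_Ici
  have h := lintegral_fun_norm_addHaar μ hm
  rw [← lintegral_Ioi_rpow_neg_sub_one hb hδ, ← lintegral_indicator measurableSet_ball.compl]
  convert h using 2
  · ext x
    simp [indicator]
  · rw [setLIntegral_congr Ioi_ae_eq_Ici, ← lintegral_indicator measurableSet_Ici,
      ← lintegral_indicator measurableSet_Ioi]
    congr 1
    ext y
    by_cases hyδ : δ ≤ y
    · have hy : 0 < y := hδ.trans_le hyδ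
      simp [hy, hyδ, ofReal_pow_mul_ofReal_rpow Module.finrank_pos hy]
    · simp [indicator, hyδ]

end PowerIntegrals

section StrongType

variable {E : Type*} [NormedAddCommGroup E] [NormedSpace ℝ E] [FiniteDimensional ℝ E]
  [MeasurableSpace E] [BorelSpace E] (μ : Measure E) [μ.IsAddHaarMeasure]

/-- Only the part of `g` above height `t / 2` matters for the superlevel set at height `t`. -/
theorem ofReal_mul_measure_lt_truncatedMaximal_le (R : ℝ) {g : E → ℝ} {N : ℝ}
    (hN : ∀ x, g x ≤ N) {t : ℝ} (ht : 0 < t) :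
    ENNReal.ofReal (t / 2) *
        μ {x | t < (truncatedMaximal μ R (fun y => ENNReal.ofReal (g y)) x).toReal} ≤
      4 ^ Module.finrank ℝ E *
        ∫⁻ y, {y | t < 2 * g y}.indicator (fun y => ENNReal.ofReal (g y)) y ∂μ := by
  refine le_trans ?_ (mul_measure_lt_truncatedMaximal_le μ R _ (ENNReal.ofReal (t / 2)))
  gcongr with x
  intro hx
  have hx' : ENNReal.ofReal t < truncatedMaximal μ R (fun y => ENNReal.ofReal (g y)) x :=
    (ENNReal.ofReal_lt_iff_lt_toReal ht.le
      ((truncatedMaximal_ofReal_le μ R hN x).trans_lt ENNReal.ofReal_lt_top).ne).2 hx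
  have hle : truncatedMaximal μ R (fun y => ENNReal.ofReal (g y)) x ≤
      truncatedMaximal μ R
        ({y | t < 2 * g y}.indicator fun y => ENNReal.ofReal (g y)) x + ENNReal.ofReal (t / 2) := by
    refine (truncatedMaximal_mono μ R (fun y => ?_) x).trans
      (truncatedMaximal_add_const_le μ R _ _ x)
    by_cases hy : t < 2 * g y
    · simp [hy]
    · simpa [hy] using ENNReal.ofReal_le_ofReal (by linarith : g y ≤ t / 2)
  have hsplit : ENNReal.ofReal t = ENNReal.ofReal (t / 2) + ENNReal.ofReal (t / 2) := by
    rw [← ENNReal.ofReal_add (by positivity) (by positivity), add_halves]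
  rw [hsplit] at hx'
  exact lt_of_add_lt_add_right (hx'.trans_le hle)

/-- The strong type `(p,p)` inequality for the maximal function. -/
theorem lintegral_truncatedMaximal_rpow_le (R : ℝ) {p : ℝ} (hp : 1 < p) {g : E → ℝ}
    (hg : Measurable g) (h0 : ∀ x, 0 ≤ g x) {N : ℝ} (hN : ∀ x, g x ≤ N) :
    ∫⁻ x, ENNReal.ofReal
        ((truncatedMaximal μ R (fun y => ENNReal.ofReal (g y)) x).toReal ^ p) ∂μ ≤
      ENNReal.ofReal (p * (4 ^ Module.finrank ℝ E * (2 ^ p / (p - 1)))) *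
        ∫⁻ x, ENNReal.ofReal (g x ^ p) ∂μ := by
  have hMm := measurable_truncatedMaximal μ R (g := fun y => ENNReal.ofReal (g y)) (by fun_prop)
  rw [lintegral_rpow_eq_lintegral_meas_lt_mul μ (.of_forall fun _ => ENNReal.toReal_nonneg)
    hMm.ennreal_toReal.aemeasurable (by linarith), ENNReal.ofReal_mul (by linarith), mul_assoc]
  gcongr
  let H : ℝ × E → ℝ≥0∞ := {z : ℝ × E | z.1 < 2 * g z.2}.indicator
    fun z => ENNReal.ofReal (2 * g z.2) * ENNReal.ofReal (z.1 ^ (p - 1 - 1))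
  have hH : Measurable H :=
    Measurable.indicator (by fun_prop) (measurableSet_lt (by fun_prop) (by fun_prop))
  calc
    _ ≤ ∫⁻ t in Ioi (0 : ℝ), 4 ^ Module.finrank ℝ E * ∫⁻ x, H (t, x) ∂μ := by
      refine setLIntegral_mono' measurableSet_Ioi fun t (ht : 0 < t) => ?_
      have hsplit : ENNReal.ofReal (t ^ (p - 1)) =
          ENNReal.ofReal (t / 2) * ENNReal.ofReal (2 * t ^ (p - 1 - 1)) := by
        rw [← ENNReal.ofReal_mul (by positivity)]
        congr 1
        rw [Real.rpow_sub_one ht.ne' (p - 1)]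
        field_simp
      rw [hsplit, ← mul_assoc, mul_comm (μ _)]
      refine (mul_le_mul_left (ofReal_mul_measure_lt_truncatedMaximal_le μ R hN ht) _).trans_eq ?_
      rw [mul_assoc, ← lintegral_mul_const']
      · congr 2
        ext x
        by_cases hx : t < 2 * g x
        · simp only [H, indicator, mem_ofPred_eq, hx, if_true]
          rw [← ENNReal.ofReal_mul (h0 x), ← ENNReal.ofReal_mul (by linarith [h0 x])]
          congr 1
          ring
        · simp [H, hx]
      · exact ENNReal.ofReal_ne_top
    _ = 4 ^ Module.finrank ℝ E * ∫⁻ x, (∫⁻ t in Ioi (0 : ℝ), H (t, x)) ∂μ := by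
      rw [lintegral_const_mul _ hH.lintegral_prod_right',
        lintegral_lintegral_swap (f := fun t x => H (t, x)) hH.aemeasurable]
    _ = 4 ^ Module.finrank ℝ E * ∫⁻ x, ENNReal.ofReal (2 ^ p / (p - 1)) *
          ENNReal.ofReal (g x ^ p) ∂μ := by
      congr 2
      ext x
      have hx : ∫⁻ t in Ioi (0 : ℝ), H (t, x) =
          ∫⁻ t in Ioo 0 (2 * g x),
            ENNReal.ofReal (2 * g x) * ENNReal.ofReal (t ^ (p - 1 - 1)) := by
        rw [← lintegral_indicator measurableSet_Ioi, ← lintegral_indicator measurableSet_Ioo]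
        congr 1
        ext t
        by_cases ht : 0 < t <;> by_cases htx : t < 2 * g x <;> simp [H, ht, htx]
      rw [hx, lintegral_const_mul' _ _ ENNReal.ofReal_ne_top,
        lintegral_Ioo_rpow_sub_one (by linarith) (by linarith [h0 x]),
        ← ENNReal.ofReal_mul (by linarith [h0 x]),
        ← ENNReal.ofReal_mul (div_nonneg (by positivity) (by linarith))]
      congr 1
      rcases (h0 x).eq_or_lt with h | h
      · simp [← h, Real.zero_rpow (by linarith : p ≠ 0)]
      · rw [Real.rpow_sub_one (by positivity), Real.mul_rpow zero_le_two h.le]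
        field_simp
    _ = _ := by
      rw [lintegral_const_mul' _ _ ENNReal.ofReal_ne_top, ENNReal.ofReal_mul (by positivity),
        ENNReal.ofReal_pow (by norm_num), ENNReal.ofReal_ofNat, mul_assoc]

end StrongType

section PointwiseBound

variable {E : Type*} [NormedAddCommGroup E] [NormedSpace ℝ E]

theorem ofReal_abs_sub_le_lintegral_fderiv {w : E → ℝ} (hw : ContDiff ℝ 1 w) (x h : E) :
    ENNReal.ofReal |w (x + h) - w x| ≤
      ENNReal.ofReal ‖h‖ * ∫⁻ t in Ioo (0 : ℝ) 1, ENNReal.ofReal ‖fderiv ℝ w (x + t • h)‖ := by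
  have hcont : Continuous fun t : ℝ => fderiv ℝ w (x + t • h) :=
    (hw.continuous_fderiv one_ne_zero).comp (by fun_prop)
  have hderiv : ∀ t ∈ uIcc (0 : ℝ) 1,
      HasDerivAt (fun t : ℝ => w (x + t • h)) (fderiv ℝ w (x + t • h) h) t := fun t _ => by
    have h1 : HasDerivAt (fun t : ℝ => x + t • h) h t := by
      simpa using ((hasDerivAt_id t).smul_const h).const_add x
    exact ((hw.differentiable one_ne_zero) _).hasFDerivAt.comp_hasDerivAt t h1
  have hftc := intervalIntegral.integral_eq_sub_of_hasDerivAt hderiv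
    ((hcont.clm_apply continuous_const).intervalIntegrable _ _)
  simp only [one_smul, zero_smul, add_zero] at hftc
  rw [← hftc, intervalIntegral.integral_of_le zero_le_one, ← integral_Ioc_eq_integral_Ioo.symm,
    ← Real.norm_eq_abs, ofReal_norm, ← lintegral_const_mul' _ _ ENNReal.ofReal_ne_top]
  refine (enorm_integral_le_lintegral_enorm _).trans (lintegral_mono fun t => ?_)
  rw [← ofReal_norm, ← ENNReal.ofReal_mul (norm_nonneg _), mul_comm]
  exact ENNReal.ofReal_le_ofReal ((fderiv ℝ w (x + t • h)).le_opNorm h)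

variable [FiniteDimensional ℝ E] [MeasurableSpace E] [BorelSpace E]
  (μ : Measure E) [μ.IsAddHaarMeasure]

theorem setLIntegral_ball_comp_add_smul {g : E → ℝ≥0∞} (hg : Measurable g) (x : E) (r : ℝ)
    {t : ℝ} (ht : 0 < t) :
    ∫⁻ h in ball (0 : E) r, g (x + t • h) ∂μ =
      ENNReal.ofReal (t ^ Module.finrank ℝ E)⁻¹ * ∫⁻ y in ball x (t * r), g y ∂μ := by
  have hF : Measurable ((ball x (t * r)).indicator g) := hg.indicator measurableSet_ball
  rw [← lintegral_indicator measurableSet_ball, ← lintegral_indicator measurableSet_ball,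
    ← lintegral_add_left_eq_self ((ball x (t * r)).indicator g) x,
    ← abs_of_pos (inv_pos.2 (pow_pos ht _)), ← smul_eq_mul, ← lintegral_smul_measure,
    ← Measure.map_addHaar_smul μ ht.ne', lintegral_map (by fun_prop)
    (by fun_prop)]
  congr 1
  ext h
  simp [indicator, norm_smul, abs_of_pos ht, ht]

theorem setLIntegral_ball_abs_sub_le_truncatedMaximal {w : E → ℝ} (hw : ContDiff ℝ 1 w)
    {R r : ℝ} (hr : 0 < r) (hrR : r < R) (x : E) :
    ∫⁻ z in ball x r, ENNReal.ofReal |w z - w x| ∂μ ≤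
      ENNReal.ofReal r * (2 ^ Module.finrank ℝ E * μ (ball x r) *
        truncatedMaximal μ R (fun y => ENNReal.ofReal ‖fderiv ℝ w y‖) x) := by
  have hcont : Continuous (fderiv ℝ w) := hw.continuous_fderiv one_ne_zero
  have hwc : Continuous w := hw.continuous
  have hshift := setLIntegral_ball_comp_add_smul μ
    (g := fun z => ENNReal.ofReal |w z - w x|) (by fun_prop) x r one_pos
  simp only [one_smul, one_pow, inv_one, ENNReal.ofReal_one, one_mul] at hshift
  set g : E → ℝ≥0∞ := fun y => ENNReal.ofReal ‖fderiv ℝ w y‖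
  have hg : Measurable g := by fun_prop
  rw [← hshift]
  calc ∫⁻ h in ball (0 : E) r, ENNReal.ofReal |w (x + h) - w x| ∂μ
      ≤ ∫⁻ h in ball (0 : E) r,
          (ENNReal.ofReal r * ∫⁻ t in Ioo (0 : ℝ) 1, g (x + t • h)) ∂μ := by
        refine setLIntegral_mono' measurableSet_ball fun h hh => ?_
        refine (ofReal_abs_sub_le_lintegral_fderiv hw x h).trans ?_
        gcongr
        exact (mem_ball_zero_iff.1 hh).le
    _ = ENNReal.ofReal r *
          ∫⁻ t in Ioo (0 : ℝ) 1, (∫⁻ h in ball (0 : E) r, g (x + t • h) ∂μ) := by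
        rw [lintegral_const_mul' _ _ ENNReal.ofReal_ne_top, lintegral_lintegral_swap]
        exact (hg.comp (by fun_prop :
          Continuous fun z : E × ℝ => x + z.2 • z.1).measurable).aemeasurable
    _ ≤ ENNReal.ofReal r * ∫⁻ _ in Ioo (0 : ℝ) 1,
          (2 ^ Module.finrank ℝ E * μ (ball x r) * truncatedMaximal μ R g x) := by
        refine mul_le_mul_right ?_ _
        refine setLIntegral_mono' measurableSet_Ioo fun t ht => ?_
        have htr : t * r < R := lt_of_le_of_lt (by nlinarith [ht.2]) hrR
        rw [setLIntegral_ball_comp_add_smul μ hg x r ht.1]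
        refine (mul_le_mul_right (setLIntegral_ball_le_truncatedMaximal μ
          (mul_pos ht.1 hr) htr g x) _).trans_eq ?_
        have ht0 := pow_pos ht.1 (Module.finrank ℝ E)
        rw [Measure.addHaar_ball_mul_of_pos μ x ht.1, Measure.addHaar_ball_center μ x r,
          mul_left_comm (2 ^ _), ← mul_assoc, ← mul_assoc,
          ← ENNReal.ofReal_mul (inv_nonneg.2 ht0.le), inv_mul_cancel₀ ht0.ne',
          ENNReal.ofReal_one, one_mul]
    _ = _ := by simp

theorem abs_sub_le_truncatedMaximal {w : E → ℝ} (hw : ContDiff ℝ 1 w) {R : ℝ} {x y : E}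
    (hxy : 2 * ‖x - y‖ < R) :
    ENNReal.ofReal |w x - w y| ≤ ENNReal.ofReal (2 * 4 ^ Module.finrank ℝ E * ‖x - y‖) *
      (truncatedMaximal μ R (fun y => ENNReal.ofReal ‖fderiv ℝ w y‖) x +
        truncatedMaximal μ R (fun y => ENNReal.ofReal ‖fderiv ℝ w y‖) y) := by
  rcases eq_or_ne x y with rfl | hne
  · simp
  set M := truncatedMaximal μ R (fun y => ENNReal.ofReal ‖fderiv ℝ w y‖)
  set d := Module.finrank ℝ E
  set r := ‖x - y‖
  have hr : 0 < r := norm_sub_pos_iff.2 hne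
  have hwc : Continuous w := hw.continuous
  have hx := setLIntegral_ball_abs_sub_le_truncatedMaximal μ hw hr (by linarith) x (R := R)
  have hy := setLIntegral_ball_abs_sub_le_truncatedMaximal μ hw (by linarith) hxy y
  have hsub : ball x r ⊆ ball y (2 * r) := ball_subset_ball' (by rw [dist_eq_norm]; linarith)
  have hkey : ENNReal.ofReal |w x - w y| * μ (ball x r) ≤
      (ENNReal.ofReal (2 * 4 ^ d * r) * (M x + M y)) * μ (ball x r) := by
    calc ENNReal.ofReal |w x - w y| * μ (ball x r)
        = ∫⁻ _ in ball x r, ENNReal.ofReal |w x - w y| ∂μ := (setLIntegral_const _ _).symm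
      _ ≤ ∫⁻ z in ball x r, (ENNReal.ofReal |w z - w x| + ENNReal.ofReal |w z - w y|) ∂μ := by
          refine lintegral_mono fun z => ?_
          rw [← ENNReal.ofReal_add (abs_nonneg _) (abs_nonneg _), abs_sub_comm (w z) (w x)]
          exact ENNReal.ofReal_le_ofReal (abs_sub_le _ _ _)
      _ = ∫⁻ z in ball x r, ENNReal.ofReal |w z - w x| ∂μ +
            ∫⁻ z in ball x r, ENNReal.ofReal |w z - w y| ∂μ := lintegral_add_left (by fun_prop) _
      _ ≤ ENNReal.ofReal r * (2 ^ d * μ (ball x r) * M x) +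
            ENNReal.ofReal (2 * r) * (2 ^ d * μ (ball y (2 * r)) * M y) :=
          add_le_add hx ((lintegral_mono_set hsub).trans hy)
      _ = ENNReal.ofReal r * μ (ball x r) * (2 ^ d * M x + 2 * 2 ^ d * 2 ^ d * M y) := by
          rw [Measure.addHaar_ball_mul_of_pos μ y two_pos, Measure.addHaar_ball_center μ x r,
            ENNReal.ofReal_pow zero_le_two, ENNReal.ofReal_mul zero_le_two, ENNReal.ofReal_ofNat]
          ring
      _ ≤ ENNReal.ofReal r * μ (ball x r) * (2 * 4 ^ d * M x + 2 * 4 ^ d * M y) := by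
          have h1 : (2 : ℝ≥0∞) ^ d ≤ 2 * 4 ^ d := by
            calc (2 : ℝ≥0∞) ^ d ≤ 4 ^ d := by gcongr; norm_num
              _ ≤ 2 * 4 ^ d := le_mul_of_one_le_left zero_le one_le_two
          have h2 : (2 : ℝ≥0∞) * 2 ^ d * 2 ^ d = 2 * 4 ^ d := by
            rw [mul_assoc, ← mul_pow]; norm_num
          rw [h2]
          gcongr
      _ = _ := by
          rw [ENNReal.ofReal_mul (by positivity), ENNReal.ofReal_mul zero_le_two,
            ENNReal.ofReal_pow (by norm_num), ENNReal.ofReal_ofNat, ENNReal.ofReal_ofNat]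
          ring
  exact (ENNReal.mul_le_mul_iff_left (measure_ball_pos μ x hr).ne' measure_ball_lt_top.ne).1 hkey

end PointwiseBound

section RadialKernels

variable {E : Type*} [NormedAddCommGroup E] [NormedSpace ℝ E] [FiniteDimensional ℝ E]
  [MeasurableSpace E] [BorelSpace E] (μ : Measure E) [μ.IsAddHaarMeasure]

/-- A symmetric radial majorant reduces a double integral to a single one. -/
theorem lintegral_lintegral_le_of_radial {B : Set E} {f : E → E → ℝ≥0∞} {A : E → ℝ}
    {Φ : ℝ × ℝ → ℝ≥0∞} (hB : MeasurableSet B) (hA : Measurable A) (hΦ : Measurable Φ)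
    (hf : ∀ x ∈ B, ∀ y ∈ B, f x y ≤ Φ (A x, ‖x - y‖) + Φ (A y, ‖x - y‖)) :
    ∫⁻ x in B, ∫⁻ y in B, f x y ∂μ ∂μ ≤ 2 * ∫⁻ x in B, ∫⁻ h, Φ (A x, ‖h‖) ∂μ ∂μ := by
  have hm : Measurable fun z : E × E => Φ (A z.1, ‖z.1 - z.2‖) := by fun_prop
  have hle : ∀ x, ∫⁻ y in B, Φ (A x, ‖x - y‖) ∂μ ≤ ∫⁻ h, Φ (A x, ‖h‖) ∂μ := fun x =>
    (setLIntegral_le_lintegral _ _).trans_eq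
      (lintegral_sub_left_eq_self (fun h => Φ (A x, ‖h‖)) x)
  calc ∫⁻ x in B, ∫⁻ y in B, f x y ∂μ ∂μ
      ≤ ∫⁻ x in B, (∫⁻ y in B, Φ (A x, ‖x - y‖) ∂μ + ∫⁻ y in B, Φ (A y, ‖x - y‖) ∂μ) ∂μ := by
        refine setLIntegral_mono' hB fun x hx => ?_
        rw [← lintegral_add_left (by fun_prop)]
        exact setLIntegral_mono' hB fun y hy => hf x hx y hy
    _ = ∫⁻ x in B, ∫⁻ y in B, Φ (A x, ‖x - y‖) ∂μ ∂μ +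
          ∫⁻ y in B, ∫⁻ x in B, Φ (A y, ‖x - y‖) ∂μ ∂μ := by
        rw [lintegral_add_left hm.lintegral_prod_right',
          lintegral_lintegral_swap (f := fun x y => Φ (A y, ‖x - y‖))
            (by fun_prop : Measurable fun z : E × E => Φ (A z.2, ‖z.1 - z.2‖)).aemeasurable]
    _ ≤ _ := by
        rw [two_mul]
        refine add_le_add (lintegral_mono hle) (lintegral_mono fun y => ?_)
        exact (lintegral_congr fun x => by rw [norm_sub_rev]).trans_le (hle y)

variable [Nontrivial E]

theorem setLIntegral_ball_mul_rpow {γ s b δ : ℝ} (hγ : 0 < γ) (hs : s < 1) (hb : 0 ≤ b)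
    (hδ : 0 ≤ δ) :
    ∫⁻ h in ball (0 : E) δ,
        ENNReal.ofReal ((b * ‖h‖) ^ γ * ‖h‖ ^ (-(s * γ) - Module.finrank ℝ E)) ∂μ =
      Module.finrank ℝ E * μ (ball 0 1) *
        ENNReal.ofReal (b ^ γ * (δ ^ (γ * (1 - s)) / (γ * (1 - s)))) := by
  have ha : 0 < γ * (1 - s) := mul_pos hγ (by linarith)
  rw [ENNReal.ofReal_mul (by positivity), mul_left_comm, ← setLIntegral_ball_norm_rpow μ ha hδ,
    ← lintegral_const_mul' _ _ ENNReal.ofReal_ne_top]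
  refine setLIntegral_congr_fun_ae measurableSet_ball ?_
  filter_upwards [Measure.ae_ne μ 0] with h hne _
  rw [← ENNReal.ofReal_mul (by positivity), Real.mul_rpow hb (norm_nonneg _), mul_assoc,
    ← Real.rpow_add (norm_pos_iff.2 hne)]
  congr 3
  ring

theorem lintegral_min_mul_rpow_le {γ s b N : ℝ} (hγ : 0 < γ) (hs0 : 0 < s) (hs : s < 1)
    (hb : 0 ≤ b) (hN : 0 ≤ N) :
    ∫⁻ h : E, ENNReal.ofReal
        (min N (b * ‖h‖) ^ γ * ‖h‖ ^ (-(s * γ) - Module.finrank ℝ E)) ∂μ ≤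
      Module.finrank ℝ E * μ (ball 0 1) * ENNReal.ofReal
        (N ^ (γ * (1 - s)) * b ^ (s * γ) * (1 / (γ * (1 - s)) + 1 / (s * γ))) := by
  rcases hb.eq_or_lt with rfl | hb
  · simp [hN, Real.zero_rpow hγ.ne']
  rcases hN.eq_or_lt with rfl | hN
  · have hmin : ∀ h : E, min 0 (b * ‖h‖) = 0 := fun h => min_eq_left (by positivity)
    simp [hmin, Real.zero_rpow hγ.ne']
  have h1s : 0 < 1 - s := by linarith
  set δ := N / b with hδ_def
  have hδ : 0 < δ := div_pos hN hb
  rw [← lintegral_add_compl _ (measurableSet_ball (x := (0 : E)) (ε := δ))]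
  calc
    _ ≤ ∫⁻ h in ball (0 : E) δ, ENNReal.ofReal
          ((b * ‖h‖) ^ γ * ‖h‖ ^ (-(s * γ) - Module.finrank ℝ E)) ∂μ +
        ∫⁻ h in (ball (0 : E) δ)ᶜ, ENNReal.ofReal (N ^ γ) *
          ENNReal.ofReal (‖h‖ ^ (-(s * γ) - Module.finrank ℝ E)) ∂μ := by
      refine add_le_add (lintegral_mono fun h => ?_) (lintegral_mono fun h => ?_)
      · gcongr
        exact min_le_right _ _
      · rw [← ENNReal.ofReal_mul (by positivity)]
        gcongr
        exact min_le_left _ _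
    _ = _ := by
      rw [setLIntegral_ball_mul_rpow μ hγ hs hb.le hδ.le,
        lintegral_const_mul' _ _ ENNReal.ofReal_ne_top,
        setLIntegral_compl_ball_norm_rpow μ (mul_pos hs0 hγ) hδ, mul_left_comm (ENNReal.ofReal _),
        ← mul_add, ← ENNReal.ofReal_mul (by positivity),
        ← ENNReal.ofReal_add (by positivity) (by positivity)]
      congr 2
      have hbγ : b ^ γ = b ^ (γ * (1 - s)) * b ^ (s * γ) := by
        rw [← Real.rpow_add hb]; congr 1; ring
      have hNγ : N ^ γ = N ^ (γ * (1 - s)) * N ^ (s * γ) := by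
        rw [← Real.rpow_add hN]; congr 1; ring
      rw [hbγ, hNγ, hδ_def, Real.div_rpow hN.le hb.le, Real.div_rpow hN.le hb.le,
        Real.rpow_neg hN.le, Real.rpow_neg hb.le]
      field_simp

end RadialKernels

theorem setLIntegral_rpow_le_of_le {α : Type*} [MeasurableSpace α] {μ : Measure α} {B : Set α}
    {f : α → ℝ} (hf : Measurable f) (h0 : ∀ x, 0 ≤ f x) {q p : ℝ} (hq : 0 < q) (hqp : q ≤ p) :
    ∫⁻ x in B, ENNReal.ofReal (f x ^ q) ∂μ ≤
      μ B ^ (1 - q / p) * (∫⁻ x in B, ENNReal.ofReal (f x ^ p) ∂μ) ^ (q / p) := by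
  have hp : 0 < p := hq.trans_le hqp
  have hpow : ∀ r : ℝ, 0 < r → ∀ x, ENNReal.ofReal (f x ^ r) = ‖f x‖ₑ ^ r := fun r hr x => by
    rw [← ENNReal.ofReal_rpow_of_nonneg (h0 x) hr.le, Real.enorm_of_nonneg (h0 x)]
  have h := eLpNorm'_le_eLpNorm'_mul_rpow_measure_univ hq hqp
    (hf.aestronglyMeasurable (μ := μ.restrict B))
  have h' := ENNReal.rpow_le_rpow h hq.le
  rw [ENNReal.mul_rpow_of_nonneg _ _ hq.le, eLpNorm'_eq_lintegral_enorm,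
    eLpNorm'_eq_lintegral_enorm, ← ENNReal.rpow_mul, ← ENNReal.rpow_mul, ← ENNReal.rpow_mul,
    one_div_mul_cancel hq.ne', ENNReal.rpow_one, Measure.restrict_apply_univ] at h'
  simp_rw [hpow q hq, hpow p hp]
  refine h'.trans_eq ?_
  rw [mul_comm]
  congr 2 <;> field_simp

section GagliardoBound

variable {E : Type*} [NormedAddCommGroup E] [NormedSpace ℝ E] [FiniteDimensional ℝ E]
  [MeasurableSpace E] [BorelSpace E] [Nontrivial E] (μ : Measure E) [μ.IsAddHaarMeasure]

/-- Gagliardo energy on a ball, for a function with a pointwise bound by `A`. -/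
theorem exists_gagliardo_le_of_abs_sub_le {γ s K : ℝ} (hγ : 1 < γ) (hs0 : 0 < s) (hs1 : s < 1)
    (hK : 0 < K) :
    ∃ C : ℝ, 0 < C ∧ ∀ (x₀ : E) (ρ : ℝ), 0 < ρ → ∀ (w A : E → ℝ), Measurable A →
      (∀ x, 0 ≤ A x) →
      (∀ x ∈ ball x₀ ρ, ∀ y ∈ ball x₀ ρ, |w x - w y| ≤ K * ‖x - y‖ * (A x + A y)) →
      ∫⁻ x in ball x₀ ρ, ∫⁻ y in ball x₀ ρ, ENNReal.ofReal
          (|w x - w y| ^ γ / ‖x - y‖ ^ ((Module.finrank ℝ E : ℝ) + s * γ)) ∂μ ∂μ ≤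
        ENNReal.ofReal (C * ρ ^ (γ * (1 - s))) *
          ∫⁻ x in ball x₀ ρ, ENNReal.ofReal (A x ^ γ) ∂μ := by
  have h1s : 0 < 1 - s := by linarith
  set V : ℝ := Module.finrank ℝ E * (μ (ball 0 1)).toReal
  have hV : 0 < V := mul_pos (by exact_mod_cast Module.finrank_pos)
    (ENNReal.toReal_pos (measure_ball_pos μ _ one_pos).ne' measure_ball_lt_top.ne)
  have hVeq : Module.finrank ℝ E * μ (ball 0 1) = ENNReal.ofReal V := by
    rw [ENNReal.ofReal_mul (by positivity), ENNReal.ofReal_natCast,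
      ENNReal.ofReal_toReal measure_ball_lt_top.ne]
  refine ⟨2 * V * ((2 * K) ^ γ * 2 ^ (γ * (1 - s)) / (γ * (1 - s))), by positivity,
    fun x₀ ρ hρ w A hA hA0 hw => ?_⟩
  let Φ : ℝ × ℝ → ℝ≥0∞ := {z : ℝ × ℝ | z.2 < 2 * ρ}.indicator fun z => ENNReal.ofReal
    ((2 * K * z.1 * z.2) ^ γ * z.2 ^ (-(s * γ) - Module.finrank ℝ E))
  have hΦ : Measurable Φ :=
    Measurable.indicator (by fun_prop) (measurableSet_lt (by fun_prop) (by fun_prop))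
  have hrad : ∀ x, ∫⁻ h, Φ (A x, ‖h‖) ∂μ = ENNReal.ofReal V *
      ENNReal.ofReal ((2 * K * A x) ^ γ * ((2 * ρ) ^ (γ * (1 - s)) / (γ * (1 - s)))) := fun x => by
    rw [← hVeq, ← setLIntegral_ball_mul_rpow μ (by linarith) hs1
      (mul_nonneg (by positivity) (hA0 x)) (by positivity),
      ← lintegral_indicator measurableSet_ball]
    congr 1
    ext h
    simp [Φ, indicator]
  refine (lintegral_lintegral_le_of_radial μ measurableSet_ball hA hΦ fun x hx y hy => ?_).trans_eq
    ?_
  · have hxy : ‖x - y‖ < 2 * ρ := by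
      rw [← dist_eq_norm]
      linarith [dist_triangle_right x y x₀, mem_ball.1 hx, mem_ball.1 hy]
    have hmain : ∀ a b : ℝ, 0 ≤ a → a ≤ b → |w x - w y| ≤ K * ‖x - y‖ * (a + b) →
        ENNReal.ofReal (|w x - w y| ^ γ / ‖x - y‖ ^ ((Module.finrank ℝ E : ℝ) + s * γ)) ≤
          Φ (b, ‖x - y‖) := fun a b ha hab h => by
      simp only [Φ, indicator, mem_ofPred_eq, hxy, if_true]
      rw [div_eq_mul_inv, ← Real.rpow_neg (norm_nonneg _), neg_add_rev, ← sub_eq_add_neg]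
      gcongr
      refine h.trans ?_
      have := mul_le_mul_of_nonneg_left (add_le_add_left hab b)
        (by positivity : 0 ≤ K * ‖x - y‖)
      linarith
    rcases le_total (A x) (A y) with h | h
    · exact (hmain _ _ (hA0 x) h (hw x hx y hy)).trans le_add_self
    · exact (hmain _ _ (hA0 y) h (by rw [add_comm]; exact hw x hx y hy)).trans le_self_add
  · simp_rw [hrad]
    rw [← lintegral_const_mul' _ _ ENNReal.ofReal_ne_top, ← lintegral_const_mul' _ _ (by simp)]
    refine lintegral_congr fun x => ?_
    have := hA0 x
    rw [← ENNReal.ofReal_mul hV.le, ← ENNReal.ofReal_mul (by positivity),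
      ← ENNReal.ofReal_ofNat 2, ← ENNReal.ofReal_mul zero_le_two,
      Real.mul_rpow (by positivity) (hA0 x), Real.mul_rpow zero_le_two hρ.le]
    congr 1
    ring

/-- Gagliardo energy of a bounded function with a pointwise bound by `A`. -/
theorem exists_gagliardo_le_of_abs_sub_le_of_abs_le {γ s K : ℝ} (hγ : 1 < γ) (hs0 : 0 < s)
    (hs1 : s < 1) (hK : 0 < K) :
    ∃ C : ℝ, 0 < C ∧ ∀ (x₀ : E) (ρ : ℝ) (w A : E → ℝ) (m : ℝ), Measurable A →
      (∀ x, 0 ≤ A x) → (∀ x, |w x| ≤ m) →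
      (∀ x ∈ ball x₀ ρ, ∀ y ∈ ball x₀ ρ, |w x - w y| ≤ K * ‖x - y‖ * (A x + A y)) →
      ∫⁻ x in ball x₀ ρ, ∫⁻ y in ball x₀ ρ, ENNReal.ofReal
          (|w x - w y| ^ γ / ‖x - y‖ ^ ((Module.finrank ℝ E : ℝ) + s * γ)) ∂μ ∂μ ≤
        ENNReal.ofReal (C * m ^ (γ * (1 - s))) *
          ∫⁻ x in ball x₀ ρ, ENNReal.ofReal (A x ^ (s * γ)) ∂μ := by
  have h1s : 0 < 1 - s := by linarith
  set V : ℝ := Module.finrank ℝ E * (μ (ball 0 1)).toReal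
  have hV : 0 < V := mul_pos (by exact_mod_cast Module.finrank_pos)
    (ENNReal.toReal_pos (measure_ball_pos μ _ one_pos).ne' measure_ball_lt_top.ne)
  have hVeq : Module.finrank ℝ E * μ (ball 0 1) = ENNReal.ofReal V := by
    rw [ENNReal.ofReal_mul (by positivity), ENNReal.ofReal_natCast,
      ENNReal.ofReal_toReal measure_ball_lt_top.ne]
  refine ⟨2 * V * (2 ^ (γ * (1 - s)) * (2 * K) ^ (s * γ) *
    (1 / (γ * (1 - s)) + 1 / (s * γ))), by positivity, fun x₀ ρ w A m hA hA0 hm hw => ?_⟩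
  have hm0 : 0 ≤ m := (abs_nonneg _).trans (hm x₀)
  let Φ : ℝ × ℝ → ℝ≥0∞ := fun z => ENNReal.ofReal
    (min (2 * m) (2 * K * z.1 * z.2) ^ γ * z.2 ^ (-(s * γ) - Module.finrank ℝ E))
  have hΦ : Measurable Φ := by fun_prop
  refine (lintegral_lintegral_le_of_radial μ measurableSet_ball hA hΦ fun x hx y hy => ?_).trans
    ?_
  · have hmain : ∀ a b : ℝ, 0 ≤ a → a ≤ b → |w x - w y| ≤ K * ‖x - y‖ * (a + b) →
        ENNReal.ofReal (|w x - w y| ^ γ / ‖x - y‖ ^ ((Module.finrank ℝ E : ℝ) + s * γ)) ≤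
          Φ (b, ‖x - y‖) := fun a b ha hab h => by
      simp only [Φ]
      rw [div_eq_mul_inv, ← Real.rpow_neg (norm_nonneg _), neg_add_rev, ← sub_eq_add_neg]
      gcongr
      refine le_min ((abs_sub _ _).trans (by linarith [hm x, hm y])) (h.trans ?_)
      have := mul_le_mul_of_nonneg_left (add_le_add_left hab b)
        (by positivity : 0 ≤ K * ‖x - y‖)
      linarith
    rcases le_total (A x) (A y) with h | h
    · exact (hmain _ _ (hA0 x) h (hw x hx y hy)).trans le_add_self
    · exact (hmain _ _ (hA0 y) h (by rw [add_comm]; exact hw x hx y hy)).trans le_self_add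
  · rw [← lintegral_const_mul' _ _ ENNReal.ofReal_ne_top, ← lintegral_const_mul' _ _ (by simp)]
    refine lintegral_mono fun x => ?_
    have := hA0 x
    refine (mul_le_mul_right (lintegral_min_mul_rpow_le μ (by linarith) hs0 hs1
      (by positivity : 0 ≤ 2 * K * A x) (by positivity : 0 ≤ 2 * m)) _).trans_eq ?_
    rw [hVeq, ← ENNReal.ofReal_mul hV.le, ← ENNReal.ofReal_mul (by positivity),
      ← ENNReal.ofReal_ofNat 2, ← ENNReal.ofReal_mul zero_le_two,
      Real.mul_rpow (by positivity) (hA0 x), Real.mul_rpow zero_le_two hm0]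
    congr 1
    ring

/-- Gagliardo energy bound with the regime chosen by comparing `p` and `γ`. -/
theorem exists_gagliardo_le_lintegral_rpow {p γ s K : ℝ} (hγ : 1 < γ) (hs0 : 0 < s) (hs1 : s < 1)
    (hK : 0 < K) :
    ∃ C : ℝ, 0 < C ∧ ∀ (x₀ : E) (ρ : ℝ), 0 < ρ → ∀ (w A : E → ℝ) (m : ℝ), Measurable A →
      (∀ x, 0 ≤ A x) → (∀ x, |w x| ≤ m) →
      (∀ x ∈ ball x₀ ρ, ∀ y ∈ ball x₀ ρ, |w x - w y| ≤ K * ‖x - y‖ * (A x + A y)) →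
      ∫⁻ x in ball x₀ ρ, ∫⁻ y in ball x₀ ρ, ENNReal.ofReal
          (|w x - w y| ^ γ / ‖x - y‖ ^ ((Module.finrank ℝ E : ℝ) + s * γ)) ∂μ ∂μ ≤
        ENNReal.ofReal (C * (m ^ (1 - (if p < γ then s else 1)) *
            ρ ^ ((if p < γ then s else 1) - s)) ^ γ) *
          ∫⁻ x in ball x₀ ρ, ENNReal.ofReal (A x ^ ((if p < γ then s else 1) * γ)) ∂μ := by
  split_ifs with h
  · obtain ⟨C, hC, hle⟩ := exists_gagliardo_le_of_abs_sub_le_of_abs_le μ hγ hs0 hs1 hK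
    refine ⟨C, hC, fun x₀ ρ hρ w A m hA hA0 hm hw => ?_⟩
    have hm0 : 0 ≤ m := (abs_nonneg _).trans (hm x₀)
    rw [sub_self, Real.rpow_zero, mul_one, ← Real.rpow_mul hm0, mul_comm (1 - s)]
    exact hle x₀ ρ w A m hA hA0 hm hw
  · obtain ⟨C, hC, hle⟩ := exists_gagliardo_le_of_abs_sub_le μ hγ hs0 hs1 hK
    refine ⟨C, hC, fun x₀ ρ hρ w A m hA hA0 hm hw => ?_⟩
    rw [sub_self, Real.rpow_zero, one_mul, one_mul, ← Real.rpow_mul hρ.le, mul_comm (1 - s)]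
    exact hle x₀ ρ hρ w A hA hA0 hw

end GagliardoBound

/-- An iterated integral of a nonnegative function is at most the iterated lower integral. -/
theorem integral_integral_le_of_lintegral_le {α β : Type*} [MeasurableSpace α] [MeasurableSpace β]
    {μ : Measure α} {ν : Measure β} {f : α → β → ℝ} (h0 : ∀ x y, 0 ≤ f x y) {c : ℝ} (hc : 0 ≤ c)
    (h : ∫⁻ x, ∫⁻ y, ENNReal.ofReal (f x y) ∂ν ∂μ ≤ ENNReal.ofReal c) :
    ∫ x, ∫ y, f x y ∂ν ∂μ ≤ c := by
  rw [← ENNReal.ofReal_le_ofReal_iff hc,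
    ← Real.enorm_of_nonneg (integral_nonneg fun x => integral_nonneg (h0 x))]
  refine (enorm_integral_le_lintegral_enorm _).trans ((lintegral_mono fun x => ?_).trans h)
  exact (enorm_integral_le_lintegral_enorm _).trans_eq
    (lintegral_congr fun y => Real.enorm_of_nonneg (h0 x y))

/-- A continuous function supported in a ball is bounded by its supremum over the ball. -/
theorem abs_le_iSup_ball {E : Type*} [PseudoMetricSpace E] {w : E → ℝ} (hw : Continuous w)
    (hc : HasCompactSupport w) {x₀ : E} {ρ : ℝ} (hsupp : tsupport w ⊆ ball x₀ ρ) (x : E) :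
    |w x| ≤ ⨆ y ∈ ball x₀ ρ, |w y| := by
  have h0 : 0 ≤ ⨆ y ∈ ball x₀ ρ, |w y| :=
    Real.iSup_nonneg fun y => Real.iSup_nonneg fun _ => abs_nonneg _
  obtain ⟨N, hN⟩ := hc.exists_bound_of_continuous hw
  by_cases hx : x ∈ ball x₀ ρ
  · have hbdd : BddAbove (range fun y => ⨆ _ : y ∈ ball x₀ ρ, |w y|) :=
      ⟨N, forall_mem_range.2 fun y =>
        Real.iSup_le (fun _ => hN y) ((norm_nonneg _).trans (hN y))⟩
    refine le_trans ?_ (le_ciSup hbdd x)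
    simp [hx]
  · rw [image_eq_zero_of_notMem_tsupport fun h => hx (hsupp h), abs_zero]
    exact h0

section MaximalBound

variable {E : Type*} [NormedAddCommGroup E] [NormedSpace ℝ E]
  [MeasurableSpace E] [BorelSpace E] (μ : Measure E) [μ.IsAddHaarMeasure]

/-- The derivative of a function supported in a ball has its `L^p` mass in the ball. -/
theorem lintegral_fderiv_rpow_eq_ofReal {p : ℝ} (hp : 0 < p) {w : E → ℝ} (hw : ContDiff ℝ 1 w)
    (hc : HasCompactSupport w) {x₀ : E} {ρ : ℝ} (hsupp : tsupport w ⊆ ball x₀ ρ) :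
    ∫⁻ x, ENNReal.ofReal (‖fderiv ℝ w x‖ ^ p) ∂μ =
      ENNReal.ofReal (∫ x in ball x₀ ρ, ‖fderiv ℝ w x‖ ^ p ∂μ) := by
  have hcont : Continuous fun x => ‖fderiv ℝ w x‖ ^ p :=
    (hw.continuous_fderiv one_ne_zero).norm.rpow_const fun _ => .inr hp.le
  have hcs : HasCompactSupport fun x => ‖fderiv ℝ w x‖ ^ p :=
    (hc.fderiv ℝ).comp_left (g := fun v => ‖v‖ ^ p) (by simp [hp.ne'])
  rw [setIntegral_eq_integral_of_forall_compl_eq_zero,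
    ofReal_integral_eq_lintegral_ofReal (hcont.integrable_of_hasCompactSupport hcs)
      (.of_forall fun x => by positivity)]
  intro x hx
  rw [image_eq_zero_of_notMem_tsupport fun h => hx (hsupp (tsupport_fderiv_subset ℝ h)),
    norm_zero, Real.zero_rpow hp.ne']

variable [FiniteDimensional ℝ E]

/-- A function `A` controlling difference quotients of `w`, bounded in `L^p` by `Dw`. -/
theorem exists_abs_sub_le_and_lintegral_rpow_le {p : ℝ} (hp : 1 < p) {w : E → ℝ}
    (hw : ContDiff ℝ 1 w) (hc : HasCompactSupport w) {R : ℝ} :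
    ∃ A : E → ℝ, Measurable A ∧ (∀ x, 0 ≤ A x) ∧
      (∀ x y, 2 * ‖x - y‖ < R →
        |w x - w y| ≤ 2 * 4 ^ Module.finrank ℝ E * ‖x - y‖ * (A x + A y)) ∧
      ∫⁻ x, ENNReal.ofReal (A x ^ p) ∂μ ≤
        ENNReal.ofReal (p * (4 ^ Module.finrank ℝ E * (2 ^ p / (p - 1)))) *
          ∫⁻ x, ENNReal.ofReal (‖fderiv ℝ w x‖ ^ p) ∂μ := by
  have hcont : Continuous fun x => ‖fderiv ℝ w x‖ := (hw.continuous_fderiv one_ne_zero).norm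
  obtain ⟨N, hN⟩ := (hc.fderiv ℝ).exists_bound_of_continuous (hw.continuous_fderiv one_ne_zero)
  set M := truncatedMaximal μ R fun y => ENNReal.ofReal ‖fderiv ℝ w y‖
  have hM : ∀ x, M x ≠ ∞ := fun x =>
    ((truncatedMaximal_ofReal_le μ R hN x).trans_lt ENNReal.ofReal_lt_top).ne
  refine ⟨fun x => (M x).toReal,
    (measurable_truncatedMaximal μ R hcont.measurable.ennreal_ofReal).ennreal_toReal,
    fun x => ENNReal.toReal_nonneg, fun x y hxy => ?_,
    lintegral_truncatedMaximal_rpow_le μ R hp hcont.measurable (fun _ => norm_nonneg _) hN⟩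
  have h := abs_sub_le_truncatedMaximal μ hw hxy
  rw [← ENNReal.ofReal_le_ofReal_iff (by positivity), ENNReal.ofReal_mul (by positivity),
    ENNReal.ofReal_add ENNReal.toReal_nonneg ENNReal.toReal_nonneg,
    ENNReal.ofReal_toReal (hM x), ENNReal.ofReal_toReal (hM y)]
  exact h

/-- The unnormalised interpolation estimate. -/
theorem exists_integral_gagliardo_le [Nontrivial E] {p γ s : ℝ} (hp : 1 < p) (hγ : 1 < γ)
    (hs0 : 0 < s) (hs1 : s < 1) (hsγ : s * γ ≤ p) :
    ∃ C : ℝ, 0 < C ∧ ∀ (x₀ : E) (ρ : ℝ), 0 < ρ → ∀ w : E → ℝ, ContDiff ℝ 1 w →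
      HasCompactSupport w → tsupport w ⊆ ball x₀ ρ →
      ∫ x in ball x₀ ρ, ∫ y in ball x₀ ρ,
          |w x - w y| ^ γ / ‖x - y‖ ^ ((Module.finrank ℝ E : ℝ) + s * γ) ∂μ ∂μ ≤
        C * ((⨆ x ∈ ball x₀ ρ, |w x|) ^ (1 - (if p < γ then s else 1)) *
            ρ ^ ((if p < γ then s else 1) - s)) ^ γ *
          ((μ (ball x₀ ρ)).toReal *
            (⨍ x in ball x₀ ρ, ‖fderiv ℝ w x‖ ^ p ∂μ) ^ ((if p < γ then s else 1) * γ / p)) := by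
  obtain ⟨C, hC, hle⟩ := exists_gagliardo_le_lintegral_rpow μ (p := p) hγ hs0 hs1
    (by positivity : (0 : ℝ) < 2 * 4 ^ Module.finrank ℝ E)
  set θ : ℝ := if p < γ then s else 1 with hθ
  have hq0 : 0 < θ * γ := by rw [hθ]; split_ifs <;> positivity
  have hqp : θ * γ ≤ p := by rw [hθ]; split_ifs <;> linarith
  have hp1 : 0 < p - 1 := by linarith
  set D : ℝ := p * (4 ^ Module.finrank ℝ E * (2 ^ p / (p - 1)))
  have hD : 0 < D := by positivity
  refine ⟨C * D ^ (θ * γ / p), by positivity, fun x₀ ρ hρ w hw hc hsupp => ?_⟩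
  obtain ⟨A, hA, hA0, hAw, hAp⟩ := exists_abs_sub_le_and_lintegral_rpow_le μ hp hw hc (R := 5 * ρ)
  have hm : ∀ x, |w x| ≤ ⨆ y ∈ ball x₀ ρ, |w y| := abs_le_iSup_ball hw.continuous hc hsupp
  have hm0 : 0 ≤ ⨆ y ∈ ball x₀ ρ, |w y| := (abs_nonneg _).trans (hm x₀)
  set m := ⨆ y ∈ ball x₀ ρ, |w y|
  have hV : 0 < (μ (ball x₀ ρ)).toReal :=
    ENNReal.toReal_pos (measure_ball_pos μ _ hρ).ne' measure_ball_lt_top.ne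
  have hVeq : μ (ball x₀ ρ) = ENNReal.ofReal (μ (ball x₀ ρ)).toReal :=
    (ENNReal.ofReal_toReal measure_ball_lt_top.ne).symm
  have hG0 : 0 ≤ ∫ x in ball x₀ ρ, ‖fderiv ℝ w x‖ ^ p ∂μ := integral_nonneg fun x => by positivity
  rw [lintegral_fderiv_rpow_eq_ofReal μ (by linarith) hw hc hsupp] at hAp
  rw [setAverage_eq, measureReal_def, smul_eq_mul]
  set V := (μ (ball x₀ ρ)).toReal
  set G := ∫ x in ball x₀ ρ, ‖fderiv ℝ w x‖ ^ p ∂μ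
  refine integral_integral_le_of_lintegral_le (fun x y => by positivity) (by positivity) ?_
  refine (hle x₀ ρ hρ w A m hA hA0 hm fun x hx y hy => hAw x y ?_).trans ?_
  · rw [← dist_eq_norm]
    linarith [dist_triangle_right x y x₀, mem_ball.1 hx, mem_ball.1 hy]
  · have hJ : ∫⁻ x in ball x₀ ρ, ENNReal.ofReal (A x ^ (θ * γ)) ∂μ ≤
        ENNReal.ofReal V ^ (1 - θ * γ / p) *
          (ENNReal.ofReal D * ENNReal.ofReal G) ^ (θ * γ / p) := by
      rw [← hVeq]
      refine (setLIntegral_rpow_le_of_le hA hA0 hq0 hqp).trans (mul_le_mul_right ?_ _)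
      exact ENNReal.rpow_le_rpow ((setLIntegral_le_lintegral _ _).trans hAp) (by positivity)
    refine (mul_le_mul_right hJ _).trans_eq ?_
    rw [← ENNReal.ofReal_mul hD.le, ENNReal.ofReal_rpow_of_pos hV,
      ENNReal.ofReal_rpow_of_nonneg (by positivity) (by positivity),
      ← ENNReal.ofReal_mul (by positivity), ← ENNReal.ofReal_mul (by positivity),
      Real.mul_rpow hD.le hG0, Real.mul_rpow (by positivity) hG0, Real.rpow_sub hV,
      Real.rpow_one, Real.inv_rpow hV.le]
    congr 1
    ring

end MaximalBound

/-- **Unified embedding/interpolation estimate.** Let `p, γ > 1`, `s ∈ (0,1)` with `sγ ≤ p`,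
and set `ϑ := s` if `γ > p`, `ϑ := 1` if `γ ≤ p`. There is a constant `c = c(n,p,s,γ) > 0`
such that for every ball `B_ρ ⊂ ℝⁿ` and every `C¹` function `w : ℝⁿ → ℝ` with compact
support contained in `B_ρ`,
`(|B_ρ|⁻¹ ∬_{B_ρ×B_ρ} |w(x)-w(y)|^γ/|x-y|^{n+sγ})^{1/γ}
  ≤ c (sup_{B_ρ}|w|)^{1-ϑ} ρ^{ϑ-s} (⨍_{B_ρ} |Dw|^p)^{ϑ/p}`,
where `(sup_{B_ρ}|w|)^{1-ϑ} = 1` when `ϑ = 1` (automatic since `x ^ (0:ℝ) = 1`). -/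
theorem unified_embedding_interpolation
    (n : ℕ) (hn : 1 ≤ n) (p γ s : ℝ) (hp : 1 < p) (hγ : 1 < γ)
    (hs : s ∈ Set.Ioo (0 : ℝ) 1) (hsγ : s * γ ≤ p) :
    ∃ c : ℝ, 0 < c ∧
      ∀ (x₀ : EuclideanSpace ℝ (Fin n)) (ρ : ℝ), 0 < ρ →
        ∀ w : EuclideanSpace ℝ (Fin n) → ℝ,
          ContDiff ℝ 1 w → HasCompactSupport w → tsupport w ⊆ ball x₀ ρ →
          ((volume (ball x₀ ρ)).toReal⁻¹ *
              ∫ x in ball x₀ ρ, ∫ y in ball x₀ ρ,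
                |w x - w y| ^ γ / ‖x - y‖ ^ ((n : ℝ) + s * γ)) ^ (1 / γ) ≤
            c * (⨆ x ∈ ball x₀ ρ, |w x|) ^ (1 - (if p < γ then s else 1)) *
              ρ ^ ((if p < γ then s else 1) - s) *
              (⨍ x in ball x₀ ρ, ‖fderiv ℝ w x‖ ^ p) ^ ((if p < γ then s else 1) / p) := by
  have : Nonempty (Fin n) := ⟨⟨0, hn⟩⟩
  obtain ⟨C, hC, hle⟩ := exists_integral_gagliardo_le
    (volume : Measure (EuclideanSpace ℝ (Fin n))) hp hγ hs.1 hs.2 hsγ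
  rw [finrank_euclideanSpace_fin] at hle
  refine ⟨C ^ (1 / γ), by positivity, fun x₀ ρ hρ w hw hc hsupp => ?_⟩
  have hγ0 : 0 < γ := by linarith
  have hV : 0 < (volume (ball x₀ ρ)).toReal :=
    ENNReal.toReal_pos (measure_ball_pos _ _ hρ).ne' measure_ball_lt_top.ne
  have hm0 : 0 ≤ ⨆ x ∈ ball x₀ ρ, |w x| :=
    Real.iSup_nonneg fun x => Real.iSup_nonneg fun _ => abs_nonneg _
  have hG0 : 0 ≤ ⨍ x in ball x₀ ρ, ‖fderiv ℝ w x‖ ^ p := by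
    rw [setAverage_eq]
    exact smul_nonneg (inv_nonneg.2 measureReal_nonneg) (integral_nonneg fun x => by positivity)
  have h := hle x₀ ρ hρ w hw hc hsupp
  generalize (if p < γ then s else 1 : ℝ) = θ at h ⊢
  generalize (⨆ x ∈ ball x₀ ρ, |w x|) = m at h hm0 ⊢
  generalize (⨍ x in ball x₀ ρ, ‖fderiv ℝ w x‖ ^ p) = G at h hG0 ⊢
  generalize (volume (ball x₀ ρ)).toReal = V at h hV ⊢
  calc _ ≤ (C * (m ^ (1 - θ) * ρ ^ (θ - s)) ^ γ * G ^ (θ * γ / p)) ^ (1 / γ) := by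
        refine Real.rpow_le_rpow (mul_nonneg (by positivity) (integral_nonneg fun x =>
          integral_nonneg fun y => by positivity)) ?_ (by positivity)
        rw [inv_mul_le_iff₀ hV]
        linarith
    _ = _ := by
        rw [Real.mul_rpow (by positivity) (by positivity), Real.mul_rpow hC.le (by positivity),
          ← Real.rpow_mul (by positivity), ← Real.rpow_mul hG0, mul_one_div_cancel hγ0.ne',
          Real.rpow_one]
        have : θ * γ / p * (1 / γ) = θ / p := by field_simp
        rw [this]
        ring
end
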